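/- Let Σ be an e-invariant type and suppose e ∈ dcl(Σ); fix a Lascar tuple b with e ∈ dcl(b). Let c and d be tuples of realizations of Σ. Then the following are equivalent: (a) c ≡^S_e d; (b) c ≡_{acl(e)∩Σ} d; (c) there is σ ∈ π_b^{-1}[Gal^0_L(Σ, e)] such that σ(c) = d. -/

import Mathlib

/- Framework: relativized Lascar groups of a first-order theory over a
hyperimaginary, following "Relativized Galois groups of first order theories
over a hyperimaginary" by H. Lee and J. Lee. -/

open FirstOrder Cardinal Pointwise

universe u

namespace RelLascar

variable {L : FirstOrder.Language.{u, u}} {M : Type u} [L.Structure M]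

/-- The group of automorphisms of the monster model `M`. -/
instance : Group (M ≃[L] M) where
  mul f g := f.comp g
  one := FirstOrder.Language.Equiv.refl L M
  inv f := f.symm
  mul_assoc f g h := (FirstOrder.Language.Equiv.comp_assoc h g f).symm
  one_mul := FirstOrder.Language.Equiv.refl_comp
  mul_one := FirstOrder.Language.Equiv.comp_refl
  inv_mul_cancel := FirstOrder.Language.Equiv.symm_comp_self

/-- Automorphisms act on the monster model. -/
instance : MulAction (M ≃[L] M) M where
  smul f x := f x
  one_smul _ := rfl
  mul_smul _ _ _ := rfl

@[simp] theorem autSmul_def (f : M ≃[L] M) (x : M) : f • x = f x := rfl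

/-- The solution set in `M` of a set of formulas in variables `ι` with
parameters `prm : π → M`. -/
def SolSet {ι π : Type u} (p : Set (L.Formula (ι ⊕ π))) (prm : π → M) : Set (ι → M) :=
  {v | ∀ φ ∈ p, φ.Realize (Sum.elim v prm)}

/-- A set of `ι`-tuples is type-definable over the parameters `prm`. -/
def TypeDefinableOver {ι π : Type u} (prm : π → M) (X : Set (ι → M)) : Prop :=
  ∃ p : Set (L.Formula (ι ⊕ π)), X = SolSet p prm

/-- Two tuples have the same (complete) type over `∅`. -/
def SameTp {ι : Type u} (c d : ι → M) : Prop :=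
  ∀ φ : L.Formula ι, φ.Realize c ↔ φ.Realize d

/-- `M` is a monster model with degree of saturation and strong homogeneity `κ`:
`κ` is uncountable, tuples of size `< κ` with the same type are conjugate under an
automorphism, and every partial type in `< κ` variables over `< κ` parameters that
is finitely realized in `M` is realized in `M`.  ("Small" means of size `< κ`.) -/
def IsMonster (κ : Cardinal.{u}) (L : FirstOrder.Language.{u, u}) (M : Type u) [L.Structure M] : Prop :=
  ℵ₀ < κ ∧
  (∀ (ι : Type u) (c d : ι → M), #ι < κ → SameTp (L := L) (M := M) c d →
      ∃ f : M ≃[L] M, ∀ i, f (c i) = d i) ∧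
  (∀ (ι π : Type u) (prm : π → M) (p : Set (L.Formula (ι ⊕ π))), #ι < κ → #π < κ →
      (∀ q : Finset (L.Formula (ι ⊕ π)), ↑q ⊆ p →
        ∃ v : ι → M, ∀ φ ∈ (q : Set (L.Formula (ι ⊕ π))), φ.Realize (Sum.elim v prm)) →
      ∃ v : ι → M, v ∈ SolSet p prm)

variable (κ : Cardinal.{u})

section Hyperimaginary

/- The hyperimaginary `e = a_E`, where `E` is the `∅`-type-definable equivalence
relation defined by the set of formulas `pE` and `a : γ → M`. -/
variable {γ : Type u} (pE : Set (L.Formula (γ ⊕ γ))) (a : γ → M)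

/-- The relation defined by a set of formulas in variables `δ ⊕ δ` (with no
parameters); for `pE` this is the equivalence relation `E`. -/
def Frel {δ : Type u} (pF : Set (L.Formula (δ ⊕ δ))) (x y : δ → M) : Prop :=
  ∀ φ ∈ pF, φ.Realize (Sum.elim x y)

/-- The class of a tuple `x` under the relation defined by `pF`; for an
equivalence relation this is the hyperimaginary `x_F` (as a set of representatives). -/
def Fclass {δ : Type u} (pF : Set (L.Formula (δ ⊕ δ))) (x : δ → M) : Set (δ → M) :=
  {y | Frel pF x y}

/-- `Aut_e(𝔠)`: the subgroup of automorphisms fixing the hyperimaginary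
`e = a_E` setwise. -/
def AutE : Subgroup (M ≃[L] M) := MulAction.stabilizer (M ≃[L] M) (Fclass pE a)

/-- `Aut_e(𝔠)` as a group. -/
abbrev Ge := ↥(AutE pE a)

/-- The hyperimaginary `e` is definable over the tuple `t` (i.e. `e ∈ dcl(t)`):
every automorphism fixing `t` pointwise fixes `e`. -/
def eInDclTuple {ι : Type u} (t : ι → M) : Prop :=
  ∀ f : M ≃[L] M, (∀ i, f (t i) = t i) → f ∈ AutE pE a

/-- The set of elements of `Aut_e(𝔠)` fixing pointwise some small elementary
substructure (model) `N` with `e ∈ dcl(N)`. -/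
def modelFixers : Set (Ge pE a) :=
  {f | ∃ N : L.ElementarySubstructure M, #N < κ ∧
        (∀ g : M ≃[L] M, (∀ x ∈ N, g x = x) → g ∈ AutE pE a) ∧
        ∀ x ∈ N, (f : M ≃[L] M) x = x}

/-- `Autf_L(𝔠, e)`: the normal subgroup of `Aut_e(𝔠)` generated by the
pointwise stabilizers of small models `N` with `e ∈ dcl(N)`. -/
def AutfL : Subgroup (Ge pE a) := Subgroup.normalClosure (modelFixers κ pE a)

/-- `c ≡ᴸ_e d` : the tuples have the same Lascar strong type over `e`. -/
def LEq {ι : Type u} (c d : ι → M) : Prop := ∃ f ∈ AutfL κ pE a, f • c = d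

theorem LEq.refl {ι : Type u} (c : ι → M) : LEq κ pE a c c :=
  ⟨1, one_mem _, one_smul _ _⟩

theorem LEq.symm {ι : Type u} {c d : ι → M} (h : LEq κ pE a c d) : LEq κ pE a d c := by
  obtain ⟨f, hf, rfl⟩ := h
  exact ⟨f⁻¹, inv_mem hf, inv_smul_smul f c⟩

theorem LEq.trans {ι : Type u} {c d e : ι → M} (h1 : LEq κ pE a c d)
    (h2 : LEq κ pE a d e) : LEq κ pE a c e := by
  obtain ⟨f, hf, rfl⟩ := h1
  obtain ⟨g, hg, rfl⟩ := h2
  exact ⟨g * f, mul_mem hg hf, (mul_smul g f c).symm ▸ rfl⟩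

end Hyperimaginary

section Sigma

variable {γ : Type u} (pE : Set (L.Formula (γ ⊕ γ))) (a : γ → M)
variable {V β : Type u} {pS : Set (L.Formula (V ⊕ β))} {bp : β → M}

/-- The solution set `Σ(𝔠)` of the partial type `Σ` (given by formulas `pS` over
the parameters `bp`). -/
abbrev Sol (pS : Set (L.Formula (V ⊕ β))) (bp : β → M) : Set (V → M) := SolSet pS bp

/-- The type of realizations of `Σ`. -/
abbrev SolT (pS : Set (L.Formula (V ⊕ β))) (bp : β → M) := ↥(Sol pS bp)

variable (pS bp) in
/-- The partial type `Σ` is `e`-invariant. -/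
def SolInv : Prop := ∀ (g : Ge pE a) (v : V → M), v ∈ Sol pS bp → g • v ∈ Sol pS bp

/-- The restriction homomorphism `Aut_e(𝔠) → Perm(Σ(𝔠))`, `f ↦ f ↾ Σ(𝔠)`. -/
def resPerm (hInv : SolInv pE a pS bp) : Ge pE a →* Equiv.Perm (SolT pS bp) where
  toFun g :=
    { toFun := fun v => ⟨g • (v : V → M), hInv g v v.2⟩
      invFun := fun v => ⟨g⁻¹ • (v : V → M), hInv g⁻¹ v v.2⟩
      left_inv := fun v => Subtype.ext (inv_smul_smul g (v : V → M))
      right_inv := fun v => Subtype.ext (smul_inv_smul g (v : V → M)) }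
  map_one' := Equiv.ext fun v => Subtype.ext (one_smul (Ge pE a) (v : V → M))
  map_mul' g h := Equiv.ext fun v => Subtype.ext (mul_smul g h (v : V → M))

/-- `Aut_e(Σ) = {f ↾ Σ(𝔠) : f ∈ Aut_e(𝔠)}`, as a subgroup of the permutations of
`Σ(𝔠)`. -/
def AutES (hInv : SolInv pE a pS bp) : Subgroup (Equiv.Perm (SolT pS bp)) :=
  (resPerm pE a hInv).range

/-- `Aut_e(Σ)` as a group. -/
abbrev GS (hInv : SolInv pE a pS bp) := ↥(AutES pE a hInv)

/-- The restriction map `ξ : Aut_e(𝔠) → Aut_e(Σ)`. -/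
def toGS (hInv : SolInv pE a pS bp) : Ge pE a →* GS pE a hInv :=
  (resPerm pE a hInv).rangeRestrict

/-- A tuple of realizations of `Σ`, flattened to a tuple of elements of `M`. -/
def flat {ι : Type u} (c : ι → SolT pS bp) : ι × V → M := fun p => (c p.1 : V → M) p.2

theorem flat_toGS_smul (hInv : SolInv pE a pS bp) {ι : Type u} (g : Ge pE a)
    (c : ι → SolT pS bp) : flat ((toGS pE a hInv g) • c) = g • flat c := rfl

theorem flat_smul_of_res (hInv : SolInv pE a pS bp) {ι : Type u} {τ : GS pE a hInv}
    {g : Ge pE a} (hg : resPerm pE a hInv g = ↑τ) (c : ι → SolT pS bp) :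
    flat (τ • c) = g • flat c := by
  have : τ = toGS pE a hInv g := Subtype.ext hg.symm
  subst this
  rfl

/-- `Autf_L(Σ, e)`: the subgroup of `Aut_e(Σ)` consisting of those restricted
automorphisms `σ` such that every small tuple of realizations of `Σ` has the same
Lascar strong type over `e` as its image under `σ`. -/
def AutfLS (hInv : SolInv pE a pS bp) : Subgroup (GS pE a hInv) where
  carrier := {σ | ∀ (ι : Type u), #ι < κ → ∀ c : ι → SolT pS bp,
      LEq κ pE a (flat c) (flat (σ • c))}
  one_mem' := by
    intro ι _ c
    rw [one_smul]
    exact LEq.refl κ pE a _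
  mul_mem' := by
    intro σ τ hσ hτ ι hι c
    rw [mul_smul]
    exact LEq.trans κ pE a (hτ ι hι c) (hσ ι hι (τ • c))
  inv_mem' := by
    intro σ hσ ι hι c
    have h := hσ ι hι (σ⁻¹ • c)
    rw [smul_inv_smul] at h
    exact LEq.symm κ pE a h

theorem AutfLS_normal (hInv : SolInv pE a pS bp) : (AutfLS κ pE a hInv).Normal := by
  constructor
  intro σ hσ τ ι hι c
  obtain ⟨g, hg⟩ := τ.2
  have hginv : resPerm pE a hInv g⁻¹ = ↑τ⁻¹ := by
    rw [map_inv, hg]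
    rfl
  obtain ⟨f, hf, hfe⟩ := hσ ι hι (τ⁻¹ • c)
  refine ⟨g * f * g⁻¹, (Subgroup.normalClosure_normal).conj_mem f hf g, ?_⟩
  have h1 : flat (τ⁻¹ • c) = g⁻¹ • flat c := flat_smul_of_res pE a hInv hginv c
  have h2 : flat ((τ * σ * τ⁻¹) • c) = g • flat (σ • τ⁻¹ • c) := by
    rw [mul_smul, mul_smul]
    exact flat_smul_of_res pE a hInv hg _
  rw [h2, ← hfe, h1, ← mul_smul, ← mul_smul]

/-- The relativized Lascar group `Gal_L(Σ, e) = Aut_e(Σ) / Autf_L(Σ, e)`. -/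
def GalL (hInv : SolInv pE a pS bp) := GS pE a hInv ⧸ AutfLS κ pE a hInv

/-- The projection `π_b : Aut_e(Σ) → Gal_L(Σ, e)`. -/
def projb (hInv : SolInv pE a pS bp) : GS pE a hInv → GalL κ pE a hInv :=
  QuotientGroup.mk

/-- The projection `π_Σ : Aut_e(𝔠) → Gal_L(Σ, e)`. -/
def projS (hInv : SolInv pE a pS bp) : Ge pE a → GalL κ pE a hInv :=
  fun g => projb κ pE a hInv (toGS pE a hInv g)

/-- A Lascar tuple in `Σ` over `e`: a small tuple `b` of realizations of `Σ` such
that `Autf_L(Σ, e) = {σ ∈ Aut_e(Σ) : b ≡ᴸ_e σ(b)}`. -/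
def IsLascarTuple (hInv : SolInv pE a pS bp) {ιb : Type u} (b : ιb → SolT pS bp) : Prop :=
  #ιb < κ ∧ ∀ σ : GS pE a hInv,
    σ ∈ AutfLS κ pE a hInv ↔ LEq κ pE a (flat b) (flat (σ • b))

variable (pS bp) in
/-- `e ∈ dcl(Σ)`: there is a small tuple of realizations of `Σ` over which `e` is
definable. -/
def eInDclSigma : Prop :=
  ∃ (ι : Type u) (c : ι → SolT pS bp), #ι < κ ∧ eInDclTuple pE a (flat c)

/-- The complete type of the tuple `v` over the parameters `prm` (with both
indexed by `ι`): the set of formulas realized by `v` with parameters `prm`. -/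
def tpOver {ι : Type u} (prm v : ι → M) : Set (L.Formula (ι ⊕ ι)) :=
  {φ | φ.Realize (Sum.elim v prm)}

/-- The type space `S_b(b) = {tp(f(b)/b) : f ∈ Aut_e(𝔠)}` over a tuple `b` of
realizations of `Σ`. -/
def Sb {ιb : Type u} (b : ιb → SolT pS bp) :
    Set (Set (L.Formula ((ιb × V) ⊕ (ιb × V)))) :=
  Set.range fun g : Ge pE a => tpOver (flat b) (g • flat b)

/-- The logic topology on a set of types: the subspace topology induced from the
product topology on `Formula → Bool` via characteristic functions. -/
noncomputable def typeSetTop {F : Type u} (X : Set (Set F)) : TopologicalSpace ↥X :=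
  TopologicalSpace.induced
    (fun p (φ : F) => (p : Set F).boolIndicator φ) inferInstance

/-- The map `ν_b : S_b(b) → Gal_L(Σ, e)`, `tp(σ(b)/b) ↦ [σ]`. -/
noncomputable def nub (hInv : SolInv pE a pS bp) {ιb : Type u} (b : ιb → SolT pS bp) :
    ↥(Sb pE a b) → GalL κ pE a hInv :=
  fun p => projS κ pE a hInv (Set.mem_range.mp p.2).choose

/-- The topology `𝔱_b` on the relativized Lascar group `Gal_L(Σ, e)`: the quotient
topology induced by `ν_b` from the logic topology on `S_b(b)`. -/
noncomputable def galTopb (hInv : SolInv pE a pS bp) {ιb : Type u}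
    (b : ιb → SolT pS bp) : TopologicalSpace (GalL κ pE a hInv) :=
  (typeSetTop (Sb pE a b)).coinduced (nub κ pE a hInv b)

end Sigma

section GalT

variable {γ : Type u} (pE : Set (L.Formula (γ ⊕ γ))) (a : γ → M)

/-- The Lascar group `Gal_L(T, e) = Aut_e(𝔠) / Autf_L(𝔠, e)`. -/
def GalT := Ge pE a ⧸ AutfL κ pE a

/-- The projection `π : Aut_e(𝔠) → Gal_L(T, e)`. -/
def projT : Ge pE a → GalT κ pE a := QuotientGroup.mk

/-- The type space `S_N(N) = {tp(f(N)/N) : f ∈ Aut_e(𝔠)}` over a small model `N`. -/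
def SMod (N : L.ElementarySubstructure M) : Set (Set (L.Formula (↥N ⊕ ↥N))) :=
  Set.range fun g : Ge pE a =>
    tpOver (Subtype.val : ↥N → M) (g • (Subtype.val : ↥N → M))

/-- The map `ν : S_N(N) → Gal_L(T, e)`, `tp(f(N)/N) ↦ [f]`. -/
noncomputable def nuT (N : L.ElementarySubstructure M) :
    ↥(SMod pE a N) → GalT κ pE a :=
  fun p => projT κ pE a (Set.mem_range.mp p.2).choose

/-- The standard quotient topology on the Lascar group `Gal_L(T, e)` induced via
the type space over a small model `N` (with `e ∈ dcl(N)`). -/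
noncomputable def galTopT (N : L.ElementarySubstructure M) :
    TopologicalSpace (GalT κ pE a) :=
  (typeSetTop (SMod pE a N)).coinduced (nuT κ pE a N)

/-- `Autf_KP(𝔠, e)`: the preimage under `π` of the closure of the identity in
`Gal_L(T, e)`. -/
noncomputable def AutfKPset (N : L.ElementarySubstructure M) : Set (Ge pE a) :=
  projT κ pE a ⁻¹' (@closure _ (galTopT κ pE a N) {projT κ pE a 1})

/-- `Autf_S(𝔠, e)`: the preimage under `π` of the connected component of the
identity in `Gal_L(T, e)`. -/
noncomputable def AutfSset (N : L.ElementarySubstructure M) : Set (Ge pE a) :=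
  projT κ pE a ⁻¹' (@connectedComponent _ (galTopT κ pE a N) (projT κ pE a 1))

/-- `c ≡ᴷᴾ_e d` : the tuples have the same KP strong type over `e`. -/
def KPeq (N : L.ElementarySubstructure M) {ι : Type u} (c d : ι → M) : Prop :=
  ∃ f ∈ AutfKPset κ pE a N, f • c = d

/-- `c ≡ˢ_e d` : the tuples have the same Shelah strong type over `e`. -/
def Seq (N : L.ElementarySubstructure M) {ι : Type u} (c d : ι → M) : Prop :=
  ∃ f ∈ AutfSset κ pE a N, f • c = d

end GalT

section Relativized

variable {γ : Type u} (pE : Set (L.Formula (γ ⊕ γ))) (a : γ → M)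
variable {V β : Type u} {pS : Set (L.Formula (V ⊕ β))} {bp : β → M}

/-- `Autf_KP(Σ, e)`: the set of restricted automorphisms fixing the KP strong
type of every small tuple of realizations of `Σ`. -/
noncomputable def AutfKPSset (hInv : SolInv pE a pS bp) (N : L.ElementarySubstructure M) :
    Set (GS pE a hInv) :=
  {σ | ∀ (ι : Type u), #ι < κ → ∀ c : ι → SolT pS bp,
      KPeq κ pE a N (flat c) (flat (σ • c))}

/-- `Autf_S(Σ, e)`: the set of restricted automorphisms fixing the Shelah strong
type of every small tuple of realizations of `Σ`. -/
noncomputable def AutfSSset (hInv : SolInv pE a pS bp) (N : L.ElementarySubstructure M) :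
    Set (GS pE a hInv) :=
  {σ | ∀ (ι : Type u), #ι < κ → ∀ c : ι → SolT pS bp,
      Seq κ pE a N (flat c) (flat (σ • c))}

/-- The orbit under `Aut_e(𝔠)` of the hyperimaginary given by the class of `x`
under the relation defined by `pF` is small ("`x_F` is bounded over `e`"). -/
def BoundedClass {δ : Type u} (pF : Set (L.Formula (δ ⊕ δ))) (x : δ → M) : Prop :=
  #↥(Set.range fun g : Ge pE a => g • Fclass pF x) < κ

/-- The orbit under `Aut_e(𝔠)` of the hyperimaginary given by the class of `x` is
finite ("`x_F` is algebraic over `e`"). -/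
def FiniteClass {δ : Type u} (pF : Set (L.Formula (δ ⊕ δ))) (x : δ → M) : Prop :=
  (Set.range fun g : Ge pE a => g • Fclass pF x).Finite

/-- `f` fixes the hyperimaginary given by the class of `x` (setwise). -/
def FixesClass (f : Ge pE a) {δ : Type u} (pF : Set (L.Formula (δ ⊕ δ)))
    (x : δ → M) : Prop :=
  f • Fclass pF x = Fclass pF x

variable (pS bp) in
/-- `f` fixes every hyperimaginary that is bounded over `e` and has a
representative which is a small tuple of realizations of `Σ`, i.e. `f` fixes
`bdd(e) ∩ Σ` pointwise. -/
def fixesAllBddS (f : Ge pE a) : Prop :=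
  ∀ (ι : Type u) (pF : Set (L.Formula ((ι × V) ⊕ (ι × V)))) (c : ι → SolT pS bp),
    #ι < κ → Equivalence (Frel (M := M) pF) → BoundedClass κ pE a pF (flat c) →
    FixesClass pE a f pF (flat c)

variable (pS bp) in
/-- `f` fixes every hyperimaginary that is algebraic over `e` and has a
representative which is a small tuple of realizations of `Σ`, i.e. `f` fixes
`acl(e) ∩ Σ` pointwise. -/
def fixesAllAclS (f : Ge pE a) : Prop :=
  ∀ (ι : Type u) (pF : Set (L.Formula ((ι × V) ⊕ (ι × V)))) (c : ι → SolT pS bp),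
    #ι < κ → Equivalence (Frel (M := M) pF) → FiniteClass pE a pF (flat c) →
    FixesClass pE a f pF (flat c)

end Relativized


section More

variable {γ : Type u} (pE : Set (L.Formula (γ ⊕ γ))) (a : γ → M)
variable {V β : Type u} {pS : Set (L.Formula (V ⊕ β))} {bp : β → M}

theorem mem_AutfLS_iff (hInv : SolInv pE a pS bp) {σ : GS pE a hInv} :
    σ ∈ AutfLS κ pE a hInv ↔ ∀ (ι : Type u), #ι < κ → ∀ c : ι → SolT pS bp,
      LEq κ pE a (flat c) (flat (σ • c)) := Iff.rfl

theorem toGS_mem_autfLS (hInv : SolInv pE a pS bp) {f : Ge pE a}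
    (hf : f ∈ AutfL κ pE a) : toGS pE a hInv f ∈ AutfLS κ pE a hInv :=
  (mem_AutfLS_iff κ pE a hInv).mpr
    (fun ι _ c => ⟨f, hf, (flat_toGS_smul pE a hInv f c).symm⟩)

instance AutfL_normal : (AutfL κ pE a).Normal :=
  Subgroup.normalClosure_normal

/-- The group structure of the relativized Lascar group `Gal_L(Σ, e)`. -/
noncomputable def galLGroup (hInv : SolInv pE a pS bp) : Group (GalL κ pE a hInv) :=
  @QuotientGroup.Quotient.group _ _ (AutfLS κ pE a hInv) (AutfLS_normal κ pE a hInv)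

/-- The natural projection `ξ_L : Gal_L(T, e) → Gal_L(Σ, e)`. -/
noncomputable def xiL (hInv : SolInv pE a pS bp) : GalT κ pE a → GalL κ pE a hInv :=
  haveI := AutfLS_normal κ pE a hInv
  ⇑(QuotientGroup.map (AutfL κ pE a) (AutfLS κ pE a hInv) (toGS pE a hInv)
    (fun _ hf => Subgroup.mem_comap.mpr (toGS_mem_autfLS κ pE a hInv hf)))

/-- The orbit equivalence relation `≡ᴴ` of a set `H` of restricted automorphisms,
on tuples of realizations of `Σ`. -/
def orbEq {hInv : SolInv pE a pS bp} (H : Set (GS pE a hInv)) {ι : Type u}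
    (c d : ι → SolT pS bp) : Prop :=
  ∃ h ∈ H, h • c = d

end More


section CompactGroups

open Topology Filter

section Saturated

variable {Γ : Type*} [TopologicalSpace Γ] [R1Space Γ]

/-- In an R₁ space, a compact set that is a union of fibres of a map identifying inseparable
points is closed. -/
theorem isClosed_of_isCompact_saturated {Y : Type*} {p : Γ → Y}
    (hp : ∀ g h : Γ, Inseparable g h → p g = p h) {s : Set Γ} (hs : IsCompact s)
    (hsat : ∀ g ∈ s, ∀ h, p g = p h → h ∈ s) : IsClosed s := by
  refine isClosed_of_closure_subset fun y hy => ?_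
  obtain ⟨x, hx, hxy⟩ := hs.mem_closure_iff_exists_inseparable.1 hy
  exact hsat x hx y (hp x y hxy)

end Saturated

/-- Refining an R₁ topology to a compact one does not change the topology coinduced by a map
that identifies the inseparable points of the coarser topology. -/
theorem coinduced_eq_of_le {Γ Y : Type*} {T T' : TopologicalSpace Γ} (hle : T ≤ T')
    (hT : @CompactSpace Γ T) (hR : @R1Space Γ T') {p : Γ → Y}
    (hp : ∀ g h : Γ, @Inseparable Γ T' g h → p g = p h) :
    T.coinduced p = T'.coinduced p := by
  refine le_antisymm (coinduced_mono hle) ?_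
  rw [← continuous_iff_coinduced_le, @continuous_iff_isClosed _ _ T' (T.coinduced p)]
  intro s hs
  rw [@isClosed_coinduced _ _ T] at hs
  have hc : @IsCompact Γ T (p ⁻¹' s) := @IsClosed.isCompact _ T _ hT hs
  have hc' : @IsCompact Γ T' (p ⁻¹' s) := by
    have := @IsCompact.image Γ Γ T T' _ id hc (continuous_id_iff_le.2 hle)
    rwa [Set.image_id] at this
  refine @isClosed_of_isCompact_saturated Γ T' hR Y p hp _ hc' fun g hg h hgh => ?_
  change p h ∈ s
  rw [← hgh]
  exact hg

section Quotient

variable {Γ X : Type*} [Group Γ] [TopologicalSpace Γ] [R1Space Γ] [TopologicalSpace X]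
  [CompactSpace X] {n : Subgroup Γ} [n.Normal]

theorem isClosed_mul_mem (hn : ∀ g h : Γ, Inseparable g h → (g : Γ ⧸ n) = h)
    {p q : X → Γ} (hp : Continuous p) (hq : Continuous q)
    (hpq : Continuous fun x => p x * q x) (hsurj : ∀ g h : Γ, ∃ x, p x = g ∧ q x = h)
    {A : Set (Γ ⧸ n)} (hA : IsClosed A) :
    IsClosed {z : Γ × Γ | ((z.1 * z.2 : Γ) : Γ ⧸ n) ∈ A} := by
  have hB : IsClosed {x : X | ((p x * q x : Γ) : Γ ⧸ n) ∈ A} :=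
    hA.preimage ((QuotientGroup.continuous_mk (N := n)).comp hpq)
  have hC := hB.isCompact.image (hp.prodMk hq)
  have key : (fun x => (p x, q x)) '' {x : X | ((p x * q x : Γ) : Γ ⧸ n) ∈ A} =
      {z : Γ × Γ | ((z.1 * z.2 : Γ) : Γ ⧸ n) ∈ A} := by
    ext ⟨g, h⟩
    constructor
    · rintro ⟨x, hx, hxe⟩
      simp only [Prod.mk.injEq] at hxe
      obtain ⟨rfl, rfl⟩ := hxe
      exact hx
    · intro hz
      obtain ⟨x, rfl, rfl⟩ := hsurj g h
      exact ⟨x, hz, rfl⟩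
  rw [key] at hC
  refine isClosed_of_isCompact_saturated
    (p := fun z : Γ × Γ => ((z.1 : Γ ⧸ n), (z.2 : Γ ⧸ n))) ?_ hC ?_
  · intro z w hzw
    exact Prod.ext (hn _ _ (hzw.map continuous_fst)) (hn _ _ (hzw.map continuous_snd))
  · intro z hz w hzw
    simp only [Prod.mk.injEq] at hzw
    change ((z.1 * z.2 : Γ) : Γ ⧸ n) ∈ A at hz
    change ((w.1 * w.2 : Γ) : Γ ⧸ n) ∈ A
    rw [QuotientGroup.mk_mul] at hz ⊢
    rwa [← hzw.1, ← hzw.2]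

/-- A quotient of a group with an R₁ topology, on which multiplication is controlled by a compact
space of pairs, is a topological group. -/
theorem isTopologicalGroup_quotient (hn : ∀ g h : Γ, Inseparable g h → (g : Γ ⧸ n) = h)
    (hinv : Continuous fun g : Γ => g⁻¹)
    {p q : X → Γ} (hp : Continuous p) (hq : Continuous q)
    (hpq : Continuous fun x => p x * q x) (hsurj : ∀ g h : Γ, ∃ x, p x = g ∧ q x = h) :
    IsTopologicalGroup (Γ ⧸ n) := by
  have hΓ : CompactSpace Γ := by
    have : Set.range p = Set.univ :=
      Set.eq_univ_of_forall fun g => (hsurj g 1).imp fun x hx => hx.1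
    exact ⟨this ▸ isCompact_range hp⟩
  have hmk : Continuous (QuotientGroup.mk : Γ → Γ ⧸ n) := QuotientGroup.continuous_mk
  have hmkq : IsQuotientMap (QuotientGroup.mk : Γ → Γ ⧸ n) := QuotientGroup.isQuotientMap_mk n
  have hM : ∀ {A : Set (Γ ⧸ n)}, IsClosed A →
      IsClosed {z : Γ × Γ | ((z.1 * z.2 : Γ) : Γ ⧸ n) ∈ A} :=
    fun hA => isClosed_mul_mem hn hp hq hpq hsurj hA
  have hleft : ∀ x : Γ ⧸ n, Continuous (x * ·) := by
    intro x
    induction x using QuotientGroup.induction_on with | H g => ?_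
    rw [hmkq.continuous_iff, continuous_iff_isClosed]
    intro A hA
    exact (hM hA).preimage (continuous_const.prodMk continuous_id : Continuous fun h : Γ => (g, h))
  have hright : ∀ x : Γ ⧸ n, Continuous (· * x) := by
    intro x
    induction x using QuotientGroup.induction_on with | H g => ?_
    rw [hmkq.continuous_iff, continuous_iff_isClosed]
    intro A hA
    exact (hM hA).preimage (continuous_id.prodMk continuous_const : Continuous fun h : Γ => (h, g))
  have hinvq : Continuous fun x : Γ ⧸ n => x⁻¹ := by
    rw [hmkq.continuous_iff]
    exact hmk.comp hinv
  have hsymm : ∀ x ∈ closure ({1} : Set (Γ ⧸ n)), ∀ W, IsOpen W → (1 : Γ ⧸ n) ∈ W → x ∈ W := by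
    intro x hx W hW h1
    have h2 : x⁻¹ ∈ closure ({1} : Set (Γ ⧸ n)) :=
      map_mem_closure hinvq hx (by rintro y rfl; simp)
    have h3 : x * x⁻¹ ∈ closure ({x} : Set (Γ ⧸ n)) :=
      map_mem_closure (hleft x) h2 (by rintro y rfl; simp)
    rw [mul_inv_cancel] at h3
    obtain ⟨y, hy, rfl⟩ := mem_closure_iff.1 h3 W hW h1
    exact hy
  have hmulW : ∀ x ∈ closure ({1} : Set (Γ ⧸ n)), ∀ y ∈ closure ({1} : Set (Γ ⧸ n)),
      ∀ W, IsOpen W → (1 : Γ ⧸ n) ∈ W → x * y ∈ W := by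
    intro x hx y hy W hW h1
    refine hsymm y hy _ (hW.preimage (hleft x)) ?_
    simpa using hsymm x hx W hW h1
  set K : Set Γ := QuotientGroup.mk ⁻¹' closure ({1} : Set (Γ ⧸ n))
  have hKc : IsClosed K := isClosed_closure.preimage hmk
  have h1K : (1 : Γ) ∈ K := subset_closure rfl
  have hnbhd : ∀ U : Set Γ, IsOpen U → K ⊆ U →
      {x : Γ ⧸ n | ∀ g : Γ, (g : Γ ⧸ n) = x → g ∈ U} ∈ 𝓝 (1 : Γ ⧸ n) := by
    intro U hU hKU
    have hD : IsClosed {x : X | p x * q x ∈ Uᶜ ∧ q x ∈ K} :=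
      (hU.isClosed_compl.preimage hpq).inter (hKc.preimage hq)
    have hDc := hD.isCompact.image hp
    have hDcl : IsClosed (p '' {x : X | p x * q x ∈ Uᶜ ∧ q x ∈ K}) := by
      refine isClosed_of_isCompact_saturated hn hDc ?_
      rintro _ ⟨x, ⟨hx1, hx2⟩, rfl⟩ h hxh
      obtain ⟨y, rfl, hy⟩ := hsurj h (h⁻¹ * (p x * q x))
      refine ⟨y, ⟨by rwa [hy, mul_inv_cancel_left], ?_⟩, rfl⟩
      rw [hy]
      change ((p y : Γ ⧸ n)⁻¹ * ((p x : Γ ⧸ n) * (q x : Γ ⧸ n))) ∈ closure ({1} : Set (Γ ⧸ n))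
      rw [← hxh, inv_mul_cancel_left]
      exact hx2
    have hV : IsOpen {x : Γ ⧸ n | ∃ g : Γ, (g : Γ ⧸ n) = x ∧
        g ∉ p '' {x : X | p x * q x ∈ Uᶜ ∧ q x ∈ K}} := by
      rw [← hmkq.isOpen_preimage]
      convert hDcl.isOpen_compl using 1
      ext g
      constructor
      · rintro ⟨g', hg', h1⟩ ⟨x, ⟨hx1, hx2⟩, hxg⟩
        obtain ⟨y, hy1, hy2⟩ := hsurj g' (g'⁻¹ * (p x * q x))
        refine h1 ⟨y, ⟨by rwa [hy1, hy2, mul_inv_cancel_left], ?_⟩, hy1⟩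
        rw [hy2]
        change ((g' : Γ ⧸ n)⁻¹ * ((p x : Γ ⧸ n) * (q x : Γ ⧸ n))) ∈ closure ({1} : Set (Γ ⧸ n))
        rw [hg', ← hxg, inv_mul_cancel_left]
        exact hx2
      · intro hg
        exact ⟨g, rfl, hg⟩
    refine mem_of_superset (hV.mem_nhds ⟨1, rfl, ?_⟩) ?_
    · rintro ⟨x, ⟨hx1, hx2⟩, hx3⟩
      rw [hx3, one_mul] at hx1
      exact hx1 (hKU hx2)
    · rintro _ ⟨g, rfl, hg⟩ g' hg'
      by_contra hcon
      obtain ⟨x, hx1, hx2⟩ := hsurj g (g⁻¹ * g')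
      refine hg ⟨x, ⟨by rwa [hx1, hx2, mul_inv_cancel_left], ?_⟩, hx1⟩
      rw [hx2]
      change ((g : Γ ⧸ n)⁻¹ * (g' : Γ ⧸ n)) ∈ closure ({1} : Set (Γ ⧸ n))
      rw [hg', inv_mul_cancel]
      exact subset_closure rfl
  refine IsTopologicalGroup.of_nhds_one ?_ ?_ ?_ ?_
  · intro W hW
    obtain ⟨W', hW'W, hW'o, h1W'⟩ := mem_nhds_iff.1 hW
    have hMo : IsOpen {z : Γ × Γ | ((z.1 * z.2 : Γ) : Γ ⧸ n) ∈ W'ᶜ}ᶜ :=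
      (hM hW'o.isClosed_compl).isOpen_compl
    obtain ⟨U, V, hUo, hVo, hKU, hKV, hUV⟩ :=
      generalized_tube_lemma hKc.isCompact hKc.isCompact hMo (by
        rintro ⟨g, h⟩ ⟨hg, hh⟩ hgh
        exact hgh (hmulW _ hg _ hh W' hW'o h1W'))
    rw [mem_map]
    refine mem_of_superset (prod_mem_prod (hnbhd U hUo hKU) (hnbhd V hVo hKV)) ?_
    rintro ⟨x, y⟩ ⟨hx, hy⟩
    induction x using QuotientGroup.induction_on with | H g => ?_
    induction y using QuotientGroup.induction_on with | H h => ?_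
    have := hUV (Set.mk_mem_prod (hx g rfl) (hy h rfl))
    exact hW'W (not_not.1 this)
  · simpa using hinvq.tendsto (1 : Γ ⧸ n)
  · intro x
    have h := map_eq_of_inverse (x⁻¹ * ·) (f := 𝓝 (1 : Γ ⧸ n)) (g := 𝓝 x) (φ := (x * ·))
      (by ext; simp) (by simpa using (hleft x).tendsto 1) (by simpa using (hleft x⁻¹).tendsto x)
    exact h.symm
  · intro x
    simpa [Function.comp_def] using ((hright x⁻¹).comp (hleft x)).tendsto 1

end Quotient

/-- In a compact group, a point lying in all open subgroups lies in the connected component of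
the identity. -/
theorem mem_connectedComponent_one_of_forall_openSubgroup {G : Type*} [Group G]
    [TopologicalSpace G] [IsTopologicalGroup G] [CompactSpace G] {x : G}
    (hx : ∀ U : OpenSubgroup G, x ∈ U) : x ∈ connectedComponent (1 : G) := by
  have hP : IsPreconnected ((SeparationQuotient.mk : G → SeparationQuotient G) ⁻¹'
      connectedComponent (SeparationQuotient.mk (1 : G))) := by
    rw [← SeparationQuotient.isInducing_mk.isPreconnected_image,
      Set.image_preimage_eq _ SeparationQuotient.surjective_mk]
    exact isPreconnected_connectedComponent
  refine hP.subset_connectedComponent mem_connectedComponent ?_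
  change SeparationQuotient.mk x ∈ connectedComponent (SeparationQuotient.mk (1 : G))
  have : CompactSpace (SeparationQuotient G) := Quotient.compactSpace
  rw [connectedComponent_eq_iInter_isClopen, Set.mem_iInter]
  rintro ⟨W, hW, h1⟩
  obtain ⟨H, hH⟩ := IsTopologicalGroup.exist_openSubgroup_sub_clopen_nhds_of_one
    (hW.preimage (SeparationQuotient.continuous_mk (X := G))) h1
  exact hH (hx H)

/-- The connected component of the identity is contained in every open subgroup. -/
theorem connectedComponent_one_subset_openSubgroup {G : Type*} [Group G]
    [TopologicalSpace G] [IsTopologicalGroup G] (U : OpenSubgroup G) :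
    connectedComponent (1 : G) ⊆ U :=
  U.isClopen.connectedComponent_subset (one_mem U)

/-- If a compact set meets every open subgroup of a compact group, then it meets the connected
component of the identity. -/
theorem exists_mem_connectedComponent_one {G : Type*} [Group G]
    [TopologicalSpace G] [IsTopologicalGroup G] [CompactSpace G] {s : Set G} (hs : IsCompact s)
    (h : ∀ U : OpenSubgroup G, (s ∩ U).Nonempty) : (s ∩ connectedComponent (1 : G)).Nonempty := by
  obtain ⟨x, hxs, hx⟩ := hs.inter_iInter_nonempty (fun U : OpenSubgroup G => (U : Set G))
    (fun U => U.isClosed) fun F => by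
      obtain ⟨x, hxs, hx⟩ := h (F.inf id)
      refine ⟨x, hxs, Set.mem_iInter₂.2 fun U hU => ?_⟩
      exact (Finset.inf_le hU : F.inf id ≤ U) hx
  exact ⟨x, hxs, mem_connectedComponent_one_of_forall_openSubgroup (Set.mem_iInter.1 hx)⟩

end CompactGroups

section TypeTopology

open Topology Filter

theorem realize_smul {α : Type u} (g : M ≃[L] M) (φ : L.Formula α) (v : α → M) :
    φ.Realize (g • v) ↔ φ.Realize v :=
  Language.StrongHomClass.realize_formula g φ

theorem realize_elim_smul {α β : Type u} (g : M ≃[L] M) (φ : L.Formula (α ⊕ β)) (v : α → M)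
    (w : β → M) : φ.Realize (Sum.elim (g • v) (g • w)) ↔ φ.Realize (Sum.elim v w) := by
  rw [← realize_smul g φ (Sum.elim v w)]
  have : Sum.elim (g • v) (g • w) = g • Sum.elim v w := by
    ext (i | i) <;> rfl
  rw [this]

/-- The topology on `X` induced by the type over `prm` of the tuple attached to a point. -/
@[reducible] noncomputable def tpTop (L : FirstOrder.Language.{u, u}) {M : Type u}
    [L.Structure M] {X : Type*} {δ π : Type u}
    (e : X → δ → M) (prm : π → M) : TopologicalSpace X :=
  TopologicalSpace.induced (fun x (φ : L.Formula (δ ⊕ π)) =>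
    Set.boolIndicator {ψ : L.Formula (δ ⊕ π) | ψ.Realize (Sum.elim (e x) prm)} φ) inferInstance

variable {X : Type*} {δ π : Type u} {e : X → δ → M} {prm : π → M}

theorem r1Space_tpTop : @R1Space X (tpTop L e prm) := R1Space.induced _

theorem continuous_tpTop_iff {Z : Type*} [TopologicalSpace Z] {f : Z → X} :
    @Continuous _ _ _ (tpTop L e prm) f ↔
      ∀ φ : L.Formula (δ ⊕ π), IsClopen {z | φ.Realize (Sum.elim (e (f z)) prm)} := by
  rw [tpTop, continuous_induced_rng, continuous_pi_iff]
  refine forall_congr' fun φ => ?_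
  rw [← continuous_boolIndicator_iff_isClopen]
  rfl

theorem isClopen_tpTop (φ : L.Formula (δ ⊕ π)) :
    @IsClopen X (tpTop L e prm) {x | φ.Realize (Sum.elim (e x) prm)} :=
  (@continuous_tpTop_iff L M _ X δ π e prm X (tpTop L e prm) id).1
    (@continuous_id X (tpTop L e prm)) φ

theorem realize_iff_of_inseparable {x y : X} (h : @Inseparable X (tpTop L e prm) x y)
    (φ : L.Formula (δ ⊕ π)) :
    φ.Realize (Sum.elim (e x) prm) ↔ φ.Realize (Sum.elim (e y) prm) :=
  @Inseparable.mem_open_iff X (tpTop L e prm) _ _ _ h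
    (@IsClopen.isOpen X (tpTop L e prm) _ (isClopen_tpTop φ))

theorem SolSet_mono {ι π : Type u} {p q : Set (L.Formula (ι ⊕ π))} (h : p ⊆ q) (prm : π → M) :
    SolSet q prm ⊆ SolSet p prm := fun _ hv φ hφ => hv φ (h hφ)

/-- Compactness of a space of realizations of a partial type. -/
theorem compactSpace_tpTop {κ : Cardinal.{u}} (hM : IsMonster κ L M) (hδ : #δ < κ) (hπ : #π < κ)
    {P : Set (L.Formula (δ ⊕ π))} (hP : ∀ x, e x ∈ SolSet P prm)
    (hreal : ∀ v ∈ SolSet P prm, ∃ x, ∀ φ : L.Formula (δ ⊕ π),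
      φ.Realize (Sum.elim (e x) prm) ↔ φ.Realize (Sum.elim v prm)) :
    @CompactSpace X (tpTop L e prm) := by
  let := tpTop L e prm
  refine ⟨isCompact_iff_ultrafilter_le_nhds.2 fun 𝒰 _ => ?_⟩
  set q : Set (L.Formula (δ ⊕ π)) := {φ | ∀ᶠ x in (𝒰 : Filter X), φ.Realize (Sum.elim (e x) prm)}
  obtain ⟨v, hv⟩ := hM.2.2 δ π prm q hδ hπ fun s hs => by
    obtain ⟨x, hx⟩ := ((Filter.eventually_all_finset s).2 fun φ hφ => hs hφ).exists
    exact ⟨e x, hx⟩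
  obtain ⟨x, hx⟩ := hreal v
    (SolSet_mono (fun φ hφ => Eventually.of_forall fun x => hP x φ hφ) prm hv)
  have hcont : ∀ φ : L.Formula (δ ⊕ π), φ.Realize (Sum.elim v prm) →
      ∀ᶠ x in (𝒰 : Filter X), φ.Realize (Sum.elim (e x) prm) := by
    intro φ hφ
    by_contra hcon
    rw [Ultrafilter.eventually_not.symm] at hcon
    exact Language.Formula.realize_not.1
      (hv φ.not (hcon.mono fun x h => Language.Formula.realize_not.2 h)) hφ
  refine ⟨x, Set.mem_univ x, ?_⟩
  refine le_of_le_of_eq ?_ (nhds_induced _ x).symm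
  rw [← map_le_iff_le_comap]
  change Tendsto _ _ _
  rw [tendsto_pi_nhds]
  intro φ
  rw [nhds_discrete, tendsto_pure]
  by_cases hφ : φ.Realize (Sum.elim v prm)
  · filter_upwards [hcont φ hφ] with y hy
    rw [(Set.mem_iff_boolIndicator _ φ).1 hy, (Set.mem_iff_boolIndicator _ φ).1 ((hx φ).2 hφ)]
  · filter_upwards [hcont φ.not (Language.Formula.realize_not.2 hφ)] with y hy
    rw [(Set.notMem_iff_boolIndicator _ φ).1 (Language.Formula.realize_not.1 hy),
      (Set.notMem_iff_boolIndicator _ φ).1 (mt (hx φ).1 hφ)]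

/-- A topology coinduced from a space of types through a choice of representatives. -/
theorem coinduced_typeSetTop_range {F X Y : Type*} (j : X → Set F) (p : X → Y)
    (hp : ∀ x y, j x = j y → p x = p y) :
    (typeSetTop (Set.range j)).coinduced (fun q => p (Set.mem_range.mp q.2).choose) =
      (TopologicalSpace.induced (fun x φ => (j x).boolIndicator φ) inferInstance).coinduced p := by
  have hsurj := Set.rangeFactorization_surjective (f := j)
  have hcomp : (fun q : Set.range j => p (Set.mem_range.mp q.2).choose) ∘
      Set.rangeFactorization j = p := by
    ext x
    exact hp _ _ (Set.mem_range.mp (Set.rangeFactorization j x).2).choose_spec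
  have hind : TopologicalSpace.induced (fun x φ => (j x).boolIndicator φ) inferInstance =
      (typeSetTop (Set.range j)).induced (Set.rangeFactorization j) := by
    rw [typeSetTop, induced_compose]
    rfl
  conv_rhs => rw [← hcomp, hind, ← @coinduced_compose _ _ _ (.induced _ (typeSetTop _))]
  congr 1
  refine le_antisymm ?_ (coinduced_le_iff_le_induced.2 le_rfl)
  intro s hs
  obtain ⟨o, ho, hos⟩ := hs
  rwa [← hsurj.preimage_injective hos]

end TypeTopology

section Automorphisms

open Topology

theorem frel_smul {δ : Type u} (pF : Set (L.Formula (δ ⊕ δ))) (g : M ≃[L] M) (x y : δ → M) :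
    Frel pF (g • x) (g • y) ↔ Frel pF x y :=
  forall₂_congr fun φ _ => realize_elim_smul g φ x y

theorem smul_Fclass {δ : Type u} (pF : Set (L.Formula (δ ⊕ δ))) (g : M ≃[L] M) (x : δ → M) :
    g • Fclass pF x = Fclass pF (g • x) := by
  ext y
  rw [Set.mem_smul_set_iff_inv_smul_mem]
  change Frel pF x (g⁻¹ • y) ↔ Frel pF (g • x) y
  rw [← frel_smul pF g x, smul_inv_smul]

theorem Fclass_eq_iff {δ : Type u} {pF : Set (L.Formula (δ ⊕ δ))}
    (hF : Equivalence (Frel (M := M) pF)) {x y : δ → M} :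
    Fclass pF x = Fclass pF y ↔ Frel pF x y := by
  constructor
  · intro h
    have hy : y ∈ Fclass pF y := hF.refl y
    rw [← h] at hy
    exact hy
  · intro h
    ext z
    exact ⟨fun hz => hF.trans (hF.symm h) hz, fun hz => hF.trans h hz⟩

variable {κ : Cardinal.{u}} {γ : Type u} {pE : Set (L.Formula (γ ⊕ γ))} {a : γ → M}

theorem mem_AutE_iff (hE : Equivalence (Frel (M := M) pE)) {g : M ≃[L] M} :
    g ∈ AutE pE a ↔ Frel pE a (g • a) := by
  rw [AutE, MulAction.mem_stabilizer_iff, smul_Fclass, eq_comm, Fclass_eq_iff hE]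

theorem fixesClass_iff {δ : Type u} {pF : Set (L.Formula (δ ⊕ δ))}
    (hF : Equivalence (Frel (M := M) pF)) {f : Ge pE a} {x : δ → M} :
    FixesClass pE a f pF x ↔ Frel pF x (f • x) := by
  rw [FixesClass, Subgroup.smul_def, smul_Fclass, eq_comm, Fclass_eq_iff hF]
  rfl

theorem mk_sum_lt (hM : IsMonster κ L M) {α β : Type u} (hα : #α < κ) (hβ : #β < κ) :
    #(α ⊕ β) < κ := by
  rw [mk_sum, lift_id, lift_id]
  exact add_lt_of_lt hM.1.le hα hβ

theorem mk_prod_lt (hM : IsMonster κ L M) {α β : Type u} (hα : #α < κ) (hβ : #β < κ) :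
    #(α × β) < κ := by
  rw [mk_prod, lift_id, lift_id]
  exact mul_lt_of_lt hM.1.le hα hβ

theorem exists_smul_eq (hM : IsMonster κ L M) {ι : Type u} (hι : #ι < κ) {c d : ι → M}
    (h : ∀ φ : L.Formula ι, φ.Realize c → φ.Realize d) : ∃ f : M ≃[L] M, f • c = d := by
  obtain ⟨f, hf⟩ := hM.2.1 ι c d hι fun φ => ⟨h φ, fun hd => by
    by_contra hc
    exact Language.Formula.realize_not.1 (h φ.not (Language.Formula.realize_not.2 hc)) hd⟩
  exact ⟨f, funext hf⟩

theorem exists_smul_eq_of_prm (hM : IsMonster κ L M) {ι π : Type u} (hι : #ι < κ) (hπ : #π < κ)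
    {c d : ι → M} {prm : π → M}
    (h : ∀ φ : L.Formula (ι ⊕ π), φ.Realize (Sum.elim c prm) → φ.Realize (Sum.elim d prm)) :
    ∃ f : M ≃[L] M, f • c = d ∧ f • prm = prm := by
  obtain ⟨f, hf⟩ := exists_smul_eq hM (mk_sum_lt hM hι hπ) h
  exact ⟨f, funext fun i => congrFun hf (Sum.inl i), funext fun i => congrFun hf (Sum.inr i)⟩

variable (pE a) in
/-- The topology on `Aut_e(𝔠)` in which the neighbourhoods of `g` are determined by the type of
`g(t)` over `t`. -/
@[reducible] noncomputable def orbTop {τ : Type u} (t : τ → M) : TopologicalSpace (Ge pE a) :=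
  tpTop L (fun g : Ge pE a => g • t) t

variable (pE a) in
/-- The topology on pairs `(g, h)` determined by the type of `(g(t), gh(t))` over `t`. -/
@[reducible] noncomputable def pairTop {τ : Type u} (t : τ → M) :
    TopologicalSpace (Ge pE a × Ge pE a) :=
  tpTop L (fun z : Ge pE a × Ge pE a => Sum.elim (z.1 • t) ((z.1 * z.2) • t)) t

theorem compactSpace_pairTop (hM : IsMonster κ L M) (hE : Equivalence (Frel (M := M) pE))
    {τ : Type u} (hτ : #τ < κ) {t : τ → M} {r : γ → τ} (hr : t ∘ r = a) :
    @CompactSpace _ (pairTop pE a t) := by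
  set P : Set (L.Formula ((τ ⊕ τ) ⊕ τ)) :=
    {ψ | (∃ φ : L.Formula τ, φ.Realize t ∧
        (ψ = φ.relabel (Sum.inl ∘ Sum.inl) ∨ ψ = φ.relabel (Sum.inl ∘ Sum.inr))) ∨
      ∃ φ ∈ pE, ψ = φ.relabel (Sum.elim (Sum.inr ∘ r) (Sum.inl ∘ Sum.inl ∘ r)) ∨
        ψ = φ.relabel (Sum.elim (Sum.inr ∘ r) (Sum.inl ∘ Sum.inr ∘ r))}
  have helim : ∀ v : τ → M, Sum.elim (t ∘ r) (v ∘ r) = Sum.elim a (v ∘ r) := fun v => by rw [hr]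
  have hcomp1 : ∀ v w : τ → M, Sum.elim (Sum.elim v w) t ∘
      Sum.elim (Sum.inr ∘ r) (Sum.inl ∘ Sum.inl ∘ r) = Sum.elim a (v ∘ r) := fun v w => by
    rw [← helim]; ext (i | i) <;> rfl
  have hcomp2 : ∀ v w : τ → M, Sum.elim (Sum.elim v w) t ∘
      Sum.elim (Sum.inr ∘ r) (Sum.inl ∘ Sum.inr ∘ r) = Sum.elim a (w ∘ r) := fun v w => by
    rw [← helim]; ext (i | i) <;> rfl
  have hsm : ∀ g : M ≃[L] M, (g • t) ∘ r = g • a := fun g => by rw [← hr]; rfl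
  refine compactSpace_tpTop hM (mk_sum_lt hM hτ hτ) hτ (P := P) ?_ ?_
  · rintro ⟨g, h⟩ ψ (⟨φ, hφ, rfl | rfl⟩ | ⟨φ, hφ, rfl | rfl⟩)
    · rw [Language.Formula.realize_relabel]
      exact (realize_smul (g : M ≃[L] M) φ t).2 hφ
    · rw [Language.Formula.realize_relabel]
      exact (realize_smul ((g * h : Ge pE a) : M ≃[L] M) φ t).2 hφ
    · rw [Language.Formula.realize_relabel, hcomp1, Subgroup.smul_def, hsm]
      exact (mem_AutE_iff hE).1 g.2 φ hφ
    · rw [Language.Formula.realize_relabel, hcomp2, Subgroup.smul_def, hsm]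
      exact (mem_AutE_iff hE).1 (g * h).2 φ hφ
  · intro v hv
    obtain ⟨f, hf⟩ := exists_smul_eq (c := t) (d := v ∘ Sum.inl) hM hτ fun φ hφ => by
      have := hv (φ.relabel (Sum.inl ∘ Sum.inl)) (.inl ⟨φ, hφ, .inl rfl⟩)
      rw [Language.Formula.realize_relabel] at this
      exact this
    obtain ⟨k, hk⟩ := exists_smul_eq (c := t) (d := v ∘ Sum.inr) hM hτ fun φ hφ => by
      have := hv (φ.relabel (Sum.inl ∘ Sum.inr)) (.inl ⟨φ, hφ, .inr rfl⟩)
      rw [Language.Formula.realize_relabel] at this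
      exact this
    have hvfk : v = Sum.elim (f • t) (k • t) := by rw [hf, hk, Sum.elim_comp_inl_inr]
    have hfE : f ∈ AutE pE a := (mem_AutE_iff hE).2 fun φ hφ => by
      have := hv _ (.inr ⟨φ, hφ, .inl rfl⟩)
      rwa [Language.Formula.realize_relabel, hvfk, hcomp1, hsm] at this
    have hkE : k ∈ AutE pE a := (mem_AutE_iff hE).2 fun φ hφ => by
      have := hv _ (.inr ⟨φ, hφ, .inr rfl⟩)
      rwa [Language.Formula.realize_relabel, hvfk, hcomp2, hsm] at this
    refine ⟨(⟨f, hfE⟩, ⟨f, hfE⟩⁻¹ * ⟨k, hkE⟩), fun φ => ?_⟩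
    rw [mul_inv_cancel_left, hvfk]
    rfl

section Continuity

variable {τ : Type u} (t : τ → M)

theorem continuous_fst_pairTop : @Continuous _ _ (pairTop pE a t) (orbTop pE a t) Prod.fst := by
  let := pairTop pE a t
  refine continuous_tpTop_iff.2 fun φ => ?_
  convert isClopen_tpTop (φ.relabel (Sum.map Sum.inl id)) using 1
  ext z
  change _ ↔ Language.Formula.Realize _ _
  rw [Language.Formula.realize_relabel, Sum.elim_comp_map]
  rfl

theorem continuous_mul_pairTop :
    @Continuous _ _ (pairTop pE a t) (orbTop pE a t) fun z => z.1 * z.2 := by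
  let := pairTop pE a t
  refine continuous_tpTop_iff.2 fun φ => ?_
  convert isClopen_tpTop (φ.relabel (Sum.map Sum.inr id)) using 1
  ext z
  change _ ↔ Language.Formula.Realize _ _
  rw [Language.Formula.realize_relabel, Sum.elim_comp_map]
  rfl

theorem continuous_snd_pairTop : @Continuous _ _ (pairTop pE a t) (orbTop pE a t) Prod.snd := by
  let := pairTop pE a t
  refine continuous_tpTop_iff.2 fun φ => ?_
  convert isClopen_tpTop (φ.relabel (Sum.elim (Sum.inl ∘ Sum.inr) (Sum.inl ∘ Sum.inl))) using 1
  ext z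
  change _ ↔ Language.Formula.Realize _ _
  rw [Language.Formula.realize_relabel]
  refine (realize_elim_smul (z.1 : M ≃[L] M) φ (z.2 • t) t).symm.trans (Eq.to_iff ?_)
  congr 1
  ext (i | i) <;> rfl

theorem continuous_inv_orbTop :
    @Continuous _ _ (orbTop pE a t) (orbTop pE a t) fun g => g⁻¹ := by
  let := orbTop pE a t
  refine continuous_tpTop_iff.2 fun φ => ?_
  convert isClopen_tpTop (φ.relabel Sum.swap) using 1
  ext g
  change _ ↔ Language.Formula.Realize _ _
  rw [Language.Formula.realize_relabel]
  refine (realize_elim_smul (g : M ≃[L] M) φ (g⁻¹ • t) t).symm.trans (Eq.to_iff ?_)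
  congr 1
  ext (i | i)
  · exact congrFun (smul_inv_smul g t) i
  · rfl

theorem orbTop_mono {σ : Type u} (r : σ → τ) : orbTop pE a t ≤ orbTop pE a (t ∘ r) := by
  rw [← continuous_id_iff_le]
  let := orbTop pE a t
  refine continuous_tpTop_iff.2 fun φ => ?_
  convert isClopen_tpTop (φ.relabel (Sum.map r r)) using 1
  ext z
  change _ ↔ Language.Formula.Realize _ _
  rw [Language.Formula.realize_relabel, Sum.elim_comp_map]
  rfl

theorem compactSpace_orbTop (hM : IsMonster κ L M) (hE : Equivalence (Frel (M := M) pE))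
    (hτ : #τ < κ) {r : γ → τ} (hr : t ∘ r = a) : @CompactSpace _ (orbTop pE a t) := by
  let := pairTop pE a t
  let := orbTop pE a t
  have := compactSpace_pairTop hM hE hτ hr
  refine ⟨?_⟩
  have h := isCompact_range (continuous_fst_pairTop (pE := pE) (a := a) t)
  rwa [Prod.fst_surjective.range_eq] at h

end Continuity

/-- Elements of `Aut_e(𝔠)` giving `t` the same type over `t` agree modulo the stabilizer
of `t`. -/
theorem inv_mul_mem_of_realize (hM : IsMonster κ L M) {τ : Type u} (hτ : #τ < κ) {t : τ → M}
    (ht : eInDclTuple pE a t) {n : Subgroup (Ge pE a)} [n.Normal]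
    (hn : ∀ k : Ge pE a, k • t = t → k ∈ n) {g h : Ge pE a}
    (hgh : ∀ φ : L.Formula (τ ⊕ τ),
      φ.Realize (Sum.elim (g • t) t) → φ.Realize (Sum.elim (h • t) t)) :
    g⁻¹ * h ∈ n := by
  obtain ⟨s, hs1, hs2⟩ := exists_smul_eq_of_prm hM hτ hτ hgh
  set s' : Ge pE a := ⟨s, ht s fun i => congrFun hs2 i⟩
  have h1 : s' ∈ n := hn s' hs2
  have h2 : h⁻¹ * s' * g ∈ n := hn _ (by
    rw [mul_smul, mul_smul, inv_smul_eq_iff]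
    exact hs1)
  have h3 : g⁻¹ * s' * g ∈ n := by
    simpa using Subgroup.Normal.conj_mem ‹n.Normal› s' h1 g⁻¹
  have := n.mul_mem h3 (n.inv_mem h2)
  simpa [mul_assoc] using this

end Automorphisms

section GaloisTopology

open Topology

variable {κ : Cardinal.{u}} {γ : Type u} {pE : Set (L.Formula (γ ⊕ γ))} {a : γ → M}

theorem tpOver_eq_iff {ι : Type u} {prm v w : ι → M} :
    tpOver (L := L) prm v = tpOver (L := L) prm w ↔ ∀ φ : L.Formula (ι ⊕ ι),
      φ.Realize (Sum.elim v prm) ↔ φ.Realize (Sum.elim w prm) :=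
  Set.ext_iff

/-- The topology coinduced on a quotient of `Aut_e(𝔠)` from the type space of a tuple can be
computed with any longer tuple. -/
theorem coinduced_typeSetTop_eq_orbTop (hM : IsMonster κ L M)
    (hE : Equivalence (Frel (M := M) pE)) {τ : Type u} (hτ : #τ < κ) {t : τ → M} {r : γ → τ}
    (hr : t ∘ r = a) {σ : Type u} (hσ : #σ < κ) {s : σ → M} {rs : σ → τ} (hrs : t ∘ rs = s)
    (hs : eInDclTuple pE a s) {n : Subgroup (Ge pE a)} [n.Normal]
    (hn : ∀ k : Ge pE a, k • s = s → k ∈ n) {Y : Type*} {p : Ge pE a → Y}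
    (hp : ∀ g h : Ge pE a, g⁻¹ * h ∈ n → p g = p h) :
    (typeSetTop (Set.range fun g : Ge pE a => tpOver (L := L) s (g • s))).coinduced
      (fun q => p (Set.mem_range.mp q.2).choose) = (orbTop pE a t).coinduced p := by
  rw [coinduced_typeSetTop_range (fun g : Ge pE a => tpOver (L := L) s (g • s)) p fun g h hgh =>
    hp g h (inv_mul_mem_of_realize hM hσ hs hn fun φ => (tpOver_eq_iff.1 hgh φ).1)]
  symm
  subst hrs
  exact coinduced_eq_of_le (orbTop_mono t rs) (compactSpace_orbTop t hM hE hτ hr) r1Space_tpTop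
    fun g h hgh => hp g h
      (inv_mul_mem_of_realize hM hσ hs hn fun φ => (realize_iff_of_inseparable hgh φ).1)

section LascarGroup

variable {N : L.ElementarySubstructure M} (hN : #N < κ)
  (hNdcl : ∀ g : M ≃[L] M, (∀ x ∈ N, g x = x) → g ∈ AutE pE a)

include hN hNdcl in
theorem mem_AutfL_of_fixes {k : Ge pE a}
    (hk : k • (Subtype.val : N → M) = Subtype.val) : k ∈ AutfL κ pE a :=
  Subgroup.subset_normalClosure ⟨N, hN, hNdcl, fun x hx => congrFun hk ⟨x, hx⟩⟩

include hN hNdcl in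
theorem galTopT_eq (hM : IsMonster κ L M) (hE : Equivalence (Frel (M := M) pE)) {τ : Type u}
    (hτ : #τ < κ) {t : τ → M} {r : γ → τ} (hr : t ∘ r = a) {rN : N → τ}
    (hrN : t ∘ rN = Subtype.val) :
    galTopT κ pE a N = (orbTop pE a t).coinduced (projT κ pE a) :=
  coinduced_typeSetTop_eq_orbTop (n := AutfL κ pE a) hM hE hτ hr hN hrN
    (fun g hg => hNdcl g fun x hx => hg ⟨x, hx⟩)
    (fun _ hk => mem_AutfL_of_fixes hN hNdcl hk) fun _ _ h => QuotientGroup.eq.2 h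

include hN hNdcl in
theorem mem_AutfL_of_inseparable (hM : IsMonster κ L M) {τ : Type u}
    {t : τ → M} {rN : N → τ} (hrN : t ∘ rN = Subtype.val) {g h : Ge pE a}
    (hgh : @Inseparable _ (orbTop pE a t) g h) : g⁻¹ * h ∈ AutfL κ pE a := by
  refine inv_mul_mem_of_realize hM hN (fun g hg => hNdcl g fun x hx => hg ⟨x, hx⟩)
    (fun _ hk => mem_AutfL_of_fixes hN hNdcl hk) (t := (Subtype.val : N → M)) fun φ hφ => ?_
  have h1 := realize_iff_of_inseparable hgh (φ.relabel (Sum.map rN rN))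
  simp only [Language.Formula.realize_relabel, Sum.elim_comp_map] at h1
  rw [← hrN] at hφ ⊢
  exact h1.1 hφ

end LascarGroup

end GaloisTopology

section RelativizedTopology

open Topology

variable {κ : Cardinal.{u}} {γ : Type u} {pE : Set (L.Formula (γ ⊕ γ))} {a : γ → M}

theorem isClosed_smul_comp_eq {τ σ : Type u} {t : τ → M} (r : σ → τ) :
    @IsClosed _ (orbTop pE a t) {g : Ge pE a | g • (t ∘ r) = t ∘ r} := by
  let := orbTop pE a t
  have h : {g : Ge pE a | g • (t ∘ r) = t ∘ r} =
      ⋂ i, {g : Ge pE a | ((Language.var (Sum.inl (r i))).equal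
        (Language.var (Sum.inr (r i))) : L.Formula (τ ⊕ τ)).Realize (Sum.elim (g • t) t)} := by
    ext g
    simp only [Set.mem_ofPred_eq, Set.mem_iInter, Language.Formula.realize_equal,
      Language.Term.realize_var, Sum.elim_inl, Sum.elim_inr]
    exact funext_iff
  rw [h]
  exact isClosed_iInter fun i => (isClopen_tpTop _).isClosed

theorem isTopologicalGroup_lascar {N : L.ElementarySubstructure M} (hN : #N < κ)
    (hNdcl : ∀ g : M ≃[L] M, (∀ x ∈ N, g x = x) → g ∈ AutE pE a)
    (hM : IsMonster κ L M) (hE : Equivalence (Frel (M := M) pE)) {τ : Type u}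
    (hτ : #τ < κ) {t : τ → M} {r : γ → τ} (hr : t ∘ r = a) {rN : N → τ}
    (hrN : t ∘ rN = Subtype.val) :
    letI := orbTop pE a t
    IsTopologicalGroup (Ge pE a ⧸ AutfL κ pE a) := by
  let := orbTop pE a t
  let := pairTop pE a t
  have : R1Space (Ge pE a) := r1Space_tpTop
  have : CompactSpace (Ge pE a × Ge pE a) := compactSpace_pairTop hM hE hτ hr
  exact isTopologicalGroup_quotient
    (fun g h hgh => QuotientGroup.eq.2 (mem_AutfL_of_inseparable hN hNdcl hM hrN hgh))
    (continuous_inv_orbTop t) (continuous_fst_pairTop t) (continuous_snd_pairTop t)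
    (continuous_mul_pairTop t) fun g h => ⟨(g, h), rfl, rfl⟩

variable {V β : Type u} {pS : Set (L.Formula (V ⊕ β))} {bp : β → M}

instance autfLS_normal (hInv : SolInv pE a pS bp) : (AutfLS κ pE a hInv).Normal :=
  AutfLS_normal κ pE a hInv

theorem flat_injective {ι : Type u} :
    Function.Injective (flat : (ι → SolT pS bp) → ι × V → M) := fun _ _ h =>
  funext fun i => Subtype.ext (funext fun v => congrFun h (i, v))

theorem projS_eq_iff {hInv : SolInv pE a pS bp} {g h : Ge pE a} :
    projS κ pE a hInv g = projS κ pE a hInv h ↔ toGS pE a hInv (g⁻¹ * h) ∈ AutfLS κ pE a hInv := by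
  rw [map_mul, map_inv]
  exact QuotientGroup.eq

theorem projT_eq_iff {g h : Ge pE a} :
    projT κ pE a g = projT κ pE a h ↔ g⁻¹ * h ∈ AutfL κ pE a :=
  QuotientGroup.eq

theorem projS_eq_of_projT_eq (hInv : SolInv pE a pS bp) {g h : Ge pE a}
    (hgh : projT κ pE a g = projT κ pE a h) : projS κ pE a hInv g = projS κ pE a hInv h :=
  projS_eq_iff.2 (toGS_mem_autfLS κ pE a hInv (projT_eq_iff.1 hgh))

theorem IsLascarTuple.toGS_mem_iff {hInv : SolInv pE a pS bp} {ιb : Type u}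
    {b : ιb → SolT pS bp} (hb : IsLascarTuple κ pE a hInv b) {g : Ge pE a} :
    toGS pE a hInv g ∈ AutfLS κ pE a hInv ↔ ∃ h ∈ AutfL κ pE a, h • flat b = g • flat b :=
  hb.2 _

theorem IsLascarTuple.toGS_mem_of_smul_eq {hInv : SolInv pE a pS bp} {ιb : Type u}
    {b : ιb → SolT pS bp} (hb : IsLascarTuple κ pE a hInv b) {g : Ge pE a}
    (hg : g • flat b = flat b) : toGS pE a hInv g ∈ AutfLS κ pE a hInv :=
  hb.toGS_mem_iff.2 ⟨1, one_mem _, by rw [one_smul, hg]⟩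

/-- The topology of the relativized Lascar group can be computed with any tuple extending the
Lascar tuple and a representative of `e`. -/
theorem galTopb_eq (hM : IsMonster κ L M) (hE : Equivalence (Frel (M := M) pE)) {τ : Type u}
    (hτ : #τ < κ) {t : τ → M} {r : γ → τ} (hr : t ∘ r = a) (hV : #V < κ)
    {hInv : SolInv pE a pS bp} {ιb : Type u} {b : ιb → SolT pS bp}
    (hb : IsLascarTuple κ pE a hInv b) (hbdcl : eInDclTuple pE a (flat b))
    {rb : ιb × V → τ} (hrb : t ∘ rb = flat b) :
    galTopb κ pE a hInv b = (orbTop pE a t).coinduced (projS κ pE a hInv) :=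
  coinduced_typeSetTop_eq_orbTop (n := (AutfLS κ pE a hInv).comap (toGS pE a hInv)) hM hE hτ hr
    (mk_prod_lt hM hb.1 hV) hrb hbdcl (fun _ hk => hb.toGS_mem_of_smul_eq hk)
    fun _ _ h => projS_eq_iff.2 h

section Components

variable {N : L.ElementarySubstructure M} (hN : #N < κ)
  (hNdcl : ∀ g : M ≃[L] M, (∀ x ∈ N, g x = x) → g ∈ AutE pE a)
  (hM : IsMonster κ L M) (hE : Equivalence (Frel (M := M) pE)) {τ : Type u}
  (hτ : #τ < κ) {t : τ → M} {r : γ → τ} (hr : t ∘ r = a) {rN : N → τ}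
  (hrN : t ∘ rN = Subtype.val) {hInv : SolInv pE a pS bp} {ιb : Type u} {b : ιb → SolT pS bp}
  (hb : IsLascarTuple κ pE a hInv b) {rb : ιb × V → τ} (hrb : t ∘ rb = flat b)

include hN hNdcl hM hE hτ hr hrN hb hrb in
/-- An automorphism which agrees over `Σ` with elements of every open subgroup of the Lascar
group agrees over `Σ` with an element of the connected component. -/
theorem exists_mem_AutfSset {f : Ge pE a}
    (hf : letI := orbTop pE a t
      ∀ U : OpenSubgroup (Ge pE a ⧸ AutfL κ pE a),
        ∃ u : Ge pE a, (u : Ge pE a ⧸ AutfL κ pE a) ∈ U ∧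
          projS κ pE a hInv f = projS κ pE a hInv u) :
    ∃ u ∈ AutfSset κ pE a N, projS κ pE a hInv f = projS κ pE a hInv u := by
  let := orbTop pE a t
  have := isTopologicalGroup_lascar hN hNdcl hM hE hτ hr hrN
  have := compactSpace_orbTop t hM hE hτ hr
  have hA : IsCompact {g : Ge pE a | g • flat b = flat b} := by
    rw [← hrb]
    exact (isClosed_smul_comp_eq rb).isCompact
  have hs := (hA.image (QuotientGroup.continuous_mk (N := AutfL κ pE a))).image
    (continuous_const_mul (f : Ge pE a ⧸ AutfL κ pE a))
  obtain ⟨_, ⟨_, ⟨k, hk, rfl⟩, rfl⟩, hx⟩ := exists_mem_connectedComponent_one hs fun U => by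
    obtain ⟨u, hu, hfu⟩ := hf U
    obtain ⟨h, hh, hhu⟩ := hb.toGS_mem_iff.1 (projS_eq_iff.1 hfu)
    refine ⟨_, ⟨_, ⟨h⁻¹ * (f⁻¹ * u), ?_, rfl⟩, rfl⟩, ?_⟩
    · change (h⁻¹ * (f⁻¹ * u)) • flat b = flat b
      rw [mul_smul, ← hhu, inv_smul_smul]
    · have h1 : ((h⁻¹ : Ge pE a) : Ge pE a ⧸ AutfL κ pE a) = 1 :=
        (QuotientGroup.eq_one_iff _).2 (inv_mem hh)
      rw [SetLike.mem_coe]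
      simpa only [QuotientGroup.mk_mul, h1, one_mul, QuotientGroup.mk_inv,
        mul_inv_cancel_left] using hu
  refine ⟨f * k, ?_, projS_eq_iff.2 ?_⟩
  · rw [AutfSset, Set.mem_preimage, galTopT_eq hN hNdcl hM hE hτ hr hrN]
    exact hx
  · rw [inv_mul_cancel_left]
    exact hb.toGS_mem_of_smul_eq hk

theorem seq_of_mem_AutfSset {u f : Ge pE a} (hu : u ∈ AutfSset κ pE a N)
    (hfu : projS κ pE a hInv f = projS κ pE a hInv u) {ι : Type u} (hι : #ι < κ)
    (c : ι → SolT pS bp) : Seq κ pE a N (flat c) (f • flat c) := by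
  obtain ⟨h, hh, hhc⟩ := projS_eq_iff.1 hfu.symm ι hι c
  refine ⟨u * h, ?_, ?_⟩
  · have : projT κ pE a (u * h) = projT κ pE a u :=
      (projT_eq_iff.2 (by rwa [inv_mul_cancel_left])).symm
    rwa [AutfSset, Set.mem_preimage, this]
  · rw [mul_smul, hhc, flat_toGS_smul, ← mul_smul, mul_inv_cancel_left]

variable (κ hInv) in
/-- The subgroup of the Lascar group of elements agreeing over `Σ` with an element of a given
subgroup. -/
def relSubgroup (U : Subgroup (Ge pE a ⧸ AutfL κ pE a)) : Subgroup (Ge pE a ⧸ AutfL κ pE a) :=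
  U ⊔ ((AutfLS κ pE a hInv).comap (toGS pE a hInv)).map (QuotientGroup.mk' _)

theorem mk_mem_relSubgroup {U : Subgroup (Ge pE a ⧸ AutfL κ pE a)} {g : Ge pE a} :
    (g : Ge pE a ⧸ AutfL κ pE a) ∈ relSubgroup κ hInv U ↔
      ∃ u : Ge pE a, (u : Ge pE a ⧸ AutfL κ pE a) ∈ U ∧
        projS κ pE a hInv g = projS κ pE a hInv u := by
  have hn : (((AutfLS κ pE a hInv).comap (toGS pE a hInv)).map
      (QuotientGroup.mk' (AutfL κ pE a))).Normal :=
    Subgroup.Normal.map inferInstance _ (QuotientGroup.mk'_surjective _)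
  rw [relSubgroup, Subgroup.mem_sup_of_normal_right]
  constructor
  · rintro ⟨u, hu, _, ⟨k, hk, rfl⟩, huk⟩
    obtain ⟨u, rfl⟩ := QuotientGroup.mk_surjective u
    refine ⟨u, hu, ?_⟩
    rw [← projS_eq_of_projT_eq hInv (g := u * k) huk, eq_comm, projS_eq_iff, inv_mul_cancel_left]
    exact hk
  · rintro ⟨u, hu, hgu⟩
    refine ⟨u, hu, _, ⟨u⁻¹ * g, projS_eq_iff.1 hgu.symm, rfl⟩, ?_⟩
    rw [QuotientGroup.mk'_apply, ← QuotientGroup.mk_mul, mul_inv_cancel_left]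

end Components

end RelativizedTopology

section ConnectedComponent

open Topology

variable {κ : Cardinal.{u}} {γ : Type u} {pE : Set (L.Formula (γ ⊕ γ))} {a : γ → M}
  {V β : Type u} {pS : Set (L.Formula (V ⊕ β))} {bp : β → M}
  {N : L.ElementarySubstructure M} (hN : #N < κ)
  (hNdcl : ∀ g : M ≃[L] M, (∀ x ∈ N, g x = x) → g ∈ AutE pE a)
  (hM : IsMonster κ L M) (hE : Equivalence (Frel (M := M) pE)) {τ : Type u}
  (hτ : #τ < κ) {t : τ → M} {r : γ → τ} (hr : t ∘ r = a) {rN : N → τ}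
  (hrN : t ∘ rN = Subtype.val) (hV : #V < κ) {hInv : SolInv pE a pS bp} {ιb : Type u}
  {b : ιb → SolT pS bp} (hb : IsLascarTuple κ pE a hInv b) (hbdcl : eInDclTuple pE a (flat b))
  {rb : ιb × V → τ} (hrb : t ∘ rb = flat b)

include hN hNdcl hM hE hτ hr hrN

theorem isClopen_mk_mem_relSubgroup :
    letI := orbTop pE a t
    ∀ U : OpenSubgroup (Ge pE a ⧸ AutfL κ pE a),
      IsClopen {g : Ge pE a | (g : Ge pE a ⧸ AutfL κ pE a) ∈ relSubgroup κ hInv U.1} := by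
  let := orbTop pE a t
  have := isTopologicalGroup_lascar hN hNdcl hM hE hτ hr hrN
  intro U
  have hW : IsClopen (relSubgroup κ hInv U.1 : Set (Ge pE a ⧸ AutfL κ pE a)) :=
    OpenSubgroup.isClopen ⟨_, Subgroup.isOpen_mono (le_sup_left : U.1 ≤ relSubgroup κ hInv U.1) U.2⟩
  exact hW.preimage (QuotientGroup.continuous_mk (N := AutfL κ pE a))

include hV hb hbdcl hrb

theorem mk_mem_relSubgroup_of_mem_connectedComponent {f : Ge pE a}
    (hf : projS κ pE a hInv f ∈
      @connectedComponent _ (galTopb κ pE a hInv b) (projb κ pE a hInv 1)) :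
    letI := orbTop pE a t
    ∀ U : OpenSubgroup (Ge pE a ⧸ AutfL κ pE a),
      (f : Ge pE a ⧸ AutfL κ pE a) ∈ relSubgroup κ hInv U.1 := by
  let := orbTop pE a t
  intro U
  rw [galTopb_eq hM hE hτ hr hV hb hbdcl hrb] at hf
  let := (orbTop pE a t).coinduced (projS κ pE a hInv)
  set s : Set (GalL κ pE a hInv) := {z | ∃ u : Ge pE a, (u : Ge pE a ⧸ AutfL κ pE a) ∈ U ∧
    z = projS κ pE a hInv u}
  have hps : projS κ pE a hInv ⁻¹' s =
      {g : Ge pE a | (g : Ge pE a ⧸ AutfL κ pE a) ∈ relSubgroup κ hInv U.1} :=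
    Set.ext fun g => mk_mem_relSubgroup.symm
  have hcl : IsClopen (projS κ pE a hInv ⁻¹' s) :=
    hps ▸ isClopen_mk_mem_relSubgroup hN hNdcl hM hE hτ hr hrN U
  have hs : IsClopen s := ⟨isClosed_coinduced.2 hcl.1, isOpen_coinduced.2 hcl.2⟩
  have h1 : projb κ pE a hInv 1 ∈ s := ⟨1, one_mem U, by rw [projS, map_one]⟩
  exact mk_mem_relSubgroup.2 (hs.connectedComponent_subset h1 hf)

theorem projS_mem_connectedComponent {f : Ge pE a} (hf : f ∈ AutfSset κ pE a N) :
    projS κ pE a hInv f ∈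
      @connectedComponent _ (galTopb κ pE a hInv b) (projb κ pE a hInv 1) := by
  rw [AutfSset, Set.mem_preimage, galTopT_eq hN hNdcl hM hE hτ hr hrN] at hf
  rw [galTopb_eq hM hE hτ hr hV hb hbdcl hrb]
  let := orbTop pE a t
  let := (orbTop pE a t).coinduced (projT κ pE a)
  let := (orbTop pE a t).coinduced (projS κ pE a hInv)
  have hξ : Continuous (xiL κ pE a hInv) :=
    continuous_coinduced_dom.2 (continuous_coinduced_rng (f := projS κ pE a hInv))
  have := hξ.image_connectedComponent_subset (projT κ pE a 1) ⟨_, hf, rfl⟩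
  have h1 : xiL κ pE a hInv (projT κ pE a 1) = projb κ pE a hInv 1 := by
    change projS κ pE a hInv 1 = _
    rw [projS, map_one]
  rwa [h1] at this

end ConnectedComponent

section FiniteClasses

theorem exists_realize_elementarySubstructure (N : L.ElementarySubstructure M) {α π : Type u}
    {prm : π → N} {φ : L.Formula (α ⊕ π)} {v : α → M}
    (h : φ.Realize (Sum.elim v (Subtype.val ∘ prm))) :
    ∃ m : α → N, φ.Realize (Sum.elim (Subtype.val ∘ m) (Subtype.val ∘ prm)) := by
  classical
  set f : φ.freeVarFinset → π ⊕ φ.freeVarFinset := fun x =>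
    Sum.elim (fun _ => Sum.inr x) Sum.inl x.1 with hf
  have h1 : (Language.Formula.iExs φ.freeVarFinset (φ.restrictFreeVar f)).Realize
      (N.subtype ∘ prm) := by
    refine Language.Formula.realize_iExs.2 ⟨fun x => Sum.elim v (Subtype.val ∘ prm) x.1, ?_⟩
    refine (Language.BoundedFormula.realize_restrictFreeVar (Sum.elim v (Subtype.val ∘ prm))
      ?_).2 h
    rintro ⟨x | x, hx⟩ <;> rfl
  rw [N.subtype.map_formula] at h1
  obtain ⟨i, hi⟩ := Language.Formula.realize_iExs.1 h1
  have hne : Nonempty (α → N) := by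
    by_cases hα : Nonempty α
    · have : Nonempty M := ⟨v hα.some⟩
      have : Nonempty N := N.elementarilyEquivalent.symm.nonempty
      exact inferInstance
    · have := not_nonempty_iff.1 hα
      exact inferInstance
  set m : α → N := fun x => if hx : Sum.inl x ∈ φ.freeVarFinset then i ⟨Sum.inl x, hx⟩
    else hne.some x
  have h2 : φ.Realize (Sum.elim m prm) := by
    refine (Language.BoundedFormula.realize_restrictFreeVar (f := f) (Sum.elim m prm) ?_).1 hi
    rintro ⟨x | x, hx⟩
    · simp [hf, m, hx]
    · rfl
  refine ⟨m, ?_⟩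
  rw [← N.subtype.map_formula, Sum.comp_elim] at h2
  exact h2

variable {κ : Cardinal.{u}} {γ : Type u} {pE : Set (L.Formula (γ ⊕ γ))} {a : γ → M}

/-- Every tuple has a global coheir over a model: a conjugate over `N` such that every formula
it satisfies over `w` is satisfied in `N`. -/
theorem exists_coheir (hM : IsMonster κ L M) {N : L.ElementarySubstructure M} (hN : #N < κ)
    {δ ω : Type u} (hδ : #δ < κ) (hω : #ω < κ) (x : δ → M) (w : ω → M) :
    ∃ k : M ≃[L] M, k • (Subtype.val : N → M) = Subtype.val ∧
      ∀ χ : L.Formula (δ ⊕ ω), χ.Realize (Sum.elim (k • x) w) →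
        ∃ m : δ → N, χ.Realize (Sum.elim (Subtype.val ∘ m) w) := by
  set prm : N ⊕ ω → M := Sum.elim Subtype.val w
  set p : Set (L.Formula (δ ⊕ (N ⊕ ω))) :=
    {θ | (∃ φ : L.Formula (δ ⊕ N), φ.Realize (Sum.elim x Subtype.val) ∧
        θ = φ.relabel (Sum.map id Sum.inl)) ∨
      ∃ χ : L.Formula (δ ⊕ ω), (¬ ∃ m : δ → N, χ.Realize (Sum.elim (Subtype.val ∘ m) w)) ∧
        θ = (χ.relabel (Sum.map id Sum.inr)).not}
  have hl : ∀ (φ : L.Formula (δ ⊕ N)) (v : δ → M), (φ.relabel (Sum.map id Sum.inl)).Realize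
      (Sum.elim v prm) ↔ φ.Realize (Sum.elim v Subtype.val) := fun φ v => by
    rw [Language.Formula.realize_relabel, Sum.elim_comp_map,
          Sum.elim_comp_inl]; rfl
  have hr : ∀ (χ : L.Formula (δ ⊕ ω)) (v : δ → M), (χ.relabel (Sum.map id Sum.inr)).Realize
      (Sum.elim v prm) ↔ χ.Realize (Sum.elim v w) := fun χ v => by
    rw [Language.Formula.realize_relabel, Sum.elim_comp_map, Sum.elim_comp_inr]; rfl
  obtain ⟨v, hv⟩ := hM.2.2 δ (N ⊕ ω) prm p hδ (mk_sum_lt hM hN hω) fun q hq => by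
    set s := {θ : L.Formula (δ ⊕ (N ⊕ ω)) | θ ∈ q ∧ ∃ φ : L.Formula (δ ⊕ N),
      φ.Realize (Sum.elim x Subtype.val) ∧ θ = φ.relabel (Sum.map id Sum.inl)}
    have hsfin : s.Finite := q.finite_toSet.subset fun θ hθ => hθ.1
    have := hsfin.to_subtype
    choose F hF1 hF2 using fun θ : s => θ.2.2
    obtain ⟨m, hm⟩ := exists_realize_elementarySubstructure N (prm := id)
      (φ := Language.Formula.iInf F) (v := x) (Language.Formula.realize_iInf.2 hF1)
    refine ⟨Subtype.val ∘ m, fun θ hθ => ?_⟩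
    rcases hq hθ with h | ⟨χ, hχ, rfl⟩
    · have h1 := (hl _ _).2 (Language.Formula.realize_iInf.1 hm ⟨θ, hθ, h⟩)
      rwa [← hF2] at h1
    · exact Language.Formula.realize_not.2 fun h => hχ ⟨m, (hr χ _).1 h⟩
  obtain ⟨k, hk, hkN⟩ := exists_smul_eq_of_prm hM hδ hN (c := x) (d := v) (prm := Subtype.val)
    fun φ hφ => (hl φ v).1 (hv _ (.inl ⟨φ, hφ, rfl⟩))
  refine ⟨k, hkN, fun χ hχ => ?_⟩
  by_contra hm
  rw [hk] at hχ
  exact Language.Formula.realize_not.1 (hv _ (.inr ⟨χ, hm, rfl⟩)) ((hr χ v).2 hχ)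

/-- Automorphisms fixing a model fix every finite orbit of hyperimaginaries. -/
theorem frel_smul_of_fixes_model (hM : IsMonster κ L M) {N : L.ElementarySubstructure M}
    (hN : #N < κ) (hNdcl : ∀ g : M ≃[L] M, (∀ x ∈ N, g x = x) → g ∈ AutE pE a) {δ : Type u}
    (hδ : #δ < κ) {pF : Set (L.Formula (δ ⊕ δ))} (hF : Equivalence (Frel (M := M) pF))
    {x : δ → M} (hx : FiniteClass pE a pF x) {f : Ge pE a}
    (hf : ∀ y ∈ N, (f : M ≃[L] M) y = y) : Frel pF x (f • x) := by
  have hO : #(Set.range fun g : Ge pE a => g • Fclass pF x) < κ :=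
    (lt_aleph0_iff_set_finite.2 hx).trans hM.1
  choose g hg using fun o : Set.range fun g : Ge pE a => g • Fclass pF x => o.2
  obtain ⟨k, hkN, hk⟩ := exists_coheir hM hN hδ (mk_prod_lt hM hO hδ) x
    fun z => (g z.1 • x) z.2
  set k' : Ge pE a := ⟨k, hNdcl k fun y hy => congrFun hkN ⟨y, hy⟩⟩
  set o : Set.range fun g : Ge pE a => g • Fclass pF x := ⟨_, k', rfl⟩
  have hko : Frel pF (k • x) (g o • x) := by
    have h := (hg o).symm
    change k • Fclass pF x = (g o : M ≃[L] M) • Fclass pF x at h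
    rw [smul_Fclass, smul_Fclass] at h
    exact (Fclass_eq_iff hF).1 h
  set y : δ → M := k⁻¹ • g o • x
  have hxy : Frel pF x y := by rwa [← frel_smul pF k, smul_inv_smul]
  have hkN' : ∀ m : δ → N, k⁻¹ • (Subtype.val ∘ m : δ → M) = Subtype.val ∘ m := fun m => by
    rw [inv_smul_eq_iff]
    exact funext fun i => (congrFun hkN (m i)).symm
  have hfN : ∀ m : δ → N, f • (Subtype.val ∘ m : δ → M) = Subtype.val ∘ m := fun m =>
    funext fun i => hf _ (m i).2
  obtain ⟨z, hz⟩ := hM.2.2 δ (δ ⊕ δ) (Sum.elim y (f • y))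
    {θ | ∃ φ ∈ pF, θ = φ.relabel (Sum.map id Sum.inl) ∨ θ = φ.relabel (Sum.map id Sum.inr)}
    hδ (mk_sum_lt hM hδ hδ) fun q hq => by
      choose F hF1 hF2 using fun θ : q => hq θ.2
      obtain ⟨m, hm⟩ := hk ((Language.Formula.iInf F).relabel
        (Sum.map id fun i => (o, i))) (by
          rw [Language.Formula.realize_relabel, Sum.elim_comp_map]
          exact Language.Formula.realize_iInf.2 fun θ => hko _ (hF1 θ))
      rw [Language.Formula.realize_relabel, Sum.elim_comp_map] at hm
      have hm' : ∀ θ, (F θ).Realize (Sum.elim (Subtype.val ∘ m) y) := fun θ => by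
        have h1 := Language.Formula.realize_iInf.1 hm θ
        rw [← hkN' m, realize_elim_smul]
        exact h1
      refine ⟨Subtype.val ∘ m, fun θ hθ => ?_⟩
      rcases hF2 ⟨θ, hθ⟩ with h | h
      · rw [show θ = _ from h, Language.Formula.realize_relabel, Sum.elim_comp_map, Sum.elim_comp_inl]
        exact hm' ⟨θ, hθ⟩
      · rw [show θ = _ from h, Language.Formula.realize_relabel, Sum.elim_comp_map,
          Sum.elim_comp_inr,
          ← hfN m]
        exact (realize_elim_smul (f : M ≃[L] M) _ _ _).2 (hm' ⟨θ, hθ⟩)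
  have hzy : Frel pF z y := fun φ hφ => by
    have := hz _ ⟨φ, hφ, .inl rfl⟩
    rwa [Language.Formula.realize_relabel, Sum.elim_comp_map, Sum.elim_comp_inl] at this
  have hzf : Frel pF z (f • y) := fun φ hφ => by
    have := hz _ ⟨φ, hφ, .inr rfl⟩
    rwa [Language.Formula.realize_relabel, Sum.elim_comp_map, Sum.elim_comp_inr] at this
  have hfxy : Frel pF (f • y) (f • x) := (frel_smul pF (f : M ≃[L] M) _ _).2 (hF.symm hxy)
  exact hF.trans hxy (hF.trans (hF.symm hzy) (hF.trans hzf hfxy))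

theorem fixesClass_of_mem_AutfL (hM : IsMonster κ L M) {δ : Type u} (hδ : #δ < κ)
    {pF : Set (L.Formula (δ ⊕ δ))} (hF : Equivalence (Frel (M := M) pF)) {x : δ → M}
    (hx : FiniteClass pE a pF x) {f : Ge pE a} (hf : f ∈ AutfL κ pE a) :
    FixesClass pE a f pF x := by
  have h : AutfL κ pE a ≤
      (MulAction.stabilizer (Ge pE a) (Fclass (M := M) pF x)).normalCore := by
    refine Subgroup.normalClosure_le_normal ?_
    rintro f ⟨N, hN, hNdcl, hf⟩ g
    have hx' : FiniteClass pE a pF (g⁻¹ • x) := by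
      refine hx.subset ?_
      rintro _ ⟨h, rfl⟩
      refine ⟨h * g⁻¹, ?_⟩
      change (h * g⁻¹) • Fclass pF x = h • Fclass pF ((g⁻¹ : Ge pE a) • x)
      rw [mul_smul]
      exact congrArg (h • ·) (smul_Fclass pF ((g⁻¹ : Ge pE a) : M ≃[L] M) x)
    have h1 := (frel_smul pF (g : M ≃[L] M) _ _).2
      (frel_smul_of_fixes_model hM hN hNdcl hδ hF hx' hf)
    rw [MulAction.mem_stabilizer_iff]
    refine (fixesClass_iff hF).2 ?_
    change Frel pF (g • g⁻¹ • x) (g • f • g⁻¹ • x) at h1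
    rwa [smul_inv_smul, smul_smul, smul_smul] at h1
  exact Subgroup.normalCore_le _ (h hf)

end FiniteClasses

section AlgebraicClosure

open Topology

variable {κ : Cardinal.{u}} {γ : Type u} {pE : Set (L.Formula (γ ⊕ γ))} {a : γ → M}

section

variable {N : L.ElementarySubstructure M} (hN : #N < κ)
  (hNdcl : ∀ g : M ≃[L] M, (∀ x ∈ N, g x = x) → g ∈ AutE pE a)
  (hM : IsMonster κ L M) (hE : Equivalence (Frel (M := M) pE)) {τ : Type u}
  (hτ : #τ < κ) {t : τ → M} {r : γ → τ} (hr : t ∘ r = a) {rN : N → τ}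
  (hrN : t ∘ rN = Subtype.val)

include hN hNdcl hM hE hτ hr hrN in
/-- Shelah strong automorphisms fix every hyperimaginary algebraic over `e`. -/
theorem fixesClass_of_mem_AutfSset {δ : Type u} (hδ : #δ < κ)
    {pF : Set (L.Formula (δ ⊕ δ))} (hF : Equivalence (Frel (M := M) pF)) {rx : δ → τ}
    (hx : FiniteClass pE a pF (t ∘ rx)) {f : Ge pE a} (hf : f ∈ AutfSset κ pE a N) :
    FixesClass pE a f pF (t ∘ rx) := by
  rw [AutfSset, Set.mem_preimage, galTopT_eq hN hNdcl hM hE hτ hr hrN] at hf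
  let := orbTop pE a t
  have := isTopologicalGroup_lascar hN hNdcl hM hE hτ hr hrN
  set S := MulAction.stabilizer (Ge pE a) (Fclass (M := M) pF (t ∘ rx))
  have hLS : AutfL κ pE a ≤ S := fun k hk => fixesClass_of_mem_AutfL hM hδ hF hx hk
  have hSfin : S.FiniteIndex := by
    have : Finite (MulAction.orbit (Ge pE a) (Fclass (M := M) pF (t ∘ rx))) := hx
    have := Finite.of_equiv _ (MulAction.orbitEquivQuotientStabilizer (Ge pE a)
      (Fclass (M := M) pF (t ∘ rx)))
    exact Subgroup.finiteIndex_of_finite_quotient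
  have hScl : IsClosed (S : Set (Ge pE a)) := by
    have h : (S : Set (Ge pE a)) = ⋂ φ ∈ pF, {g : Ge pE a |
        (φ.relabel (Sum.elim (Sum.inr ∘ rx) (Sum.inl ∘ rx))).Realize (Sum.elim (g • t) t)} := by
      ext g
      simp only [Set.mem_iInter, Set.mem_ofPred_eq, Language.Formula.realize_relabel]
      refine (fixesClass_iff hF).trans (forall₂_congr fun φ _ => Eq.to_iff ?_)
      congr 1
      ext (i | i) <;> rfl
    rw [h]
    exact isClosed_biInter fun φ _ => (isClopen_tpTop _).isClosed
  have hcomap : (S.map (QuotientGroup.mk' (AutfL κ pE a))).comap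
      (QuotientGroup.mk' (AutfL κ pE a)) = S := by
    rw [Subgroup.comap_map_eq, QuotientGroup.ker_mk', sup_eq_left.2 hLS]
  have hcl : IsClosed (S.map (QuotientGroup.mk' (AutfL κ pE a)) :
      Set (Ge pE a ⧸ AutfL κ pE a)) := by
    rw [← (QuotientGroup.isQuotientMap_mk (N := AutfL κ pE a)).isClosed_preimage]
    rwa [← hcomap] at hScl
  have hfi : (S.map (QuotientGroup.mk' (AutfL κ pE a))).FiniteIndex :=
    ⟨by
      rw [← Subgroup.index_comap_of_surjective _ (QuotientGroup.mk'_surjective _), hcomap]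
      exact hSfin.index_ne_zero⟩
  have hmem := connectedComponent_one_subset_openSubgroup
    ⟨S.map (QuotientGroup.mk' (AutfL κ pE a)), Subgroup.isOpen_of_isClosed_of_finiteIndex _ hcl⟩ hf
  change f ∈ S
  rw [← hcomap]
  exact hmem

end

section Orbits

variable {δ : Type u} (H : Subgroup (Ge pE a)) (b : δ → M)

/-- The formulas satisfied by `(b, h(b))` for all `h` in `H`. -/
def orbitType : Set (L.Formula (δ ⊕ δ)) :=
  {φ | ∀ h ∈ H, φ.Realize (Sum.elim b (h • b))}

/-- The partial type expressing that `x = y` or that `(x, y)` is conjugate to `(b, h(b))` for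
some `h` in `H`. -/
def orbitRel : Set (L.Formula (δ ⊕ δ)) :=
  {θ | ∃ φ ∈ orbitType H b, ∃ i : δ,
    θ = φ ⊔ (Language.var (Sum.inl i)).equal (Language.var (Sum.inr i))}

variable {H b}

theorem frel_orbitRel_iff {x y : δ → M} :
    Frel (orbitRel H b) x y ↔ x = y ∨ Frel (orbitType H b) x y := by
  have h : ∀ (φ : L.Formula (δ ⊕ δ)) (i : δ),
      (φ ⊔ (Language.var (Sum.inl i)).equal (Language.var (Sum.inr i)) :
        L.Formula (δ ⊕ δ)).Realize (Sum.elim x y) ↔ φ.Realize (Sum.elim x y) ∨ x i = y i :=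
    fun φ i => by
      rw [Language.Formula.realize_sup, Language.Formula.realize_equal]; rfl
  constructor
  · intro hxy
    by_contra! hne
    obtain ⟨i, hi⟩ := Function.ne_iff.1 hne.1
    refine hne.2 fun φ hφ => ?_
    exact ((h φ i).1 (hxy _ ⟨φ, hφ, i, rfl⟩)).resolve_right hi
  · rintro hxy _ ⟨φ, hφ, i, rfl⟩
    refine (h φ i).2 ?_
    rcases hxy with rfl | hxy
    · exact .inr rfl
    · exact .inl (hxy φ hφ)

variable (hM : IsMonster κ L M) (hδ : #δ < κ) (hb : eInDclTuple pE a b)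
  (hbH : ∀ g : Ge pE a, g • b = b → g ∈ H) {τ : Type u} {t : τ → M} {rb : δ → τ}
  (hrb : t ∘ rb = b) (hH : @IsCompact _ (orbTop pE a t) (H : Set (Ge pE a)))

include hM hδ hb hbH hrb hH

theorem frel_orbitType_base_iff {y : δ → M} :
    Frel (orbitType H b) b y ↔ ∃ h ∈ H, y = h • b := by
  constructor
  · intro hy
    let := orbTop pE a t
    have hre : ∀ (φ : L.Formula (δ ⊕ δ)) (g : Ge pE a),
        (φ.relabel (Sum.elim (Sum.inr ∘ rb) (Sum.inl ∘ rb))).Realize (Sum.elim (g • t) t) ↔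
          φ.Realize (Sum.elim b (g • b)) := fun φ g => by
      rw [Language.Formula.realize_relabel, ← hrb]
      refine Eq.to_iff ?_
      congr 1
      ext (i | i) <;> rfl
    obtain ⟨h, hh, hhy⟩ := hH.inter_iInter_nonempty
      (fun φ : {φ : L.Formula (δ ⊕ δ) // φ.Realize (Sum.elim b y)} =>
        {g : Ge pE a | (φ.1.relabel (Sum.elim (Sum.inr ∘ rb) (Sum.inl ∘ rb))).Realize
          (Sum.elim (g • t) t)}) (fun φ => (isClopen_tpTop _).isClosed) fun u => by
        by_contra hne
        rw [Set.not_nonempty_iff_eq_empty, Set.eq_empty_iff_forall_notMem] at hne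
        have h1 : (Language.Formula.iInf fun φ : u => φ.1.1).not ∈ orbitType H b := by
          intro h hh
          refine Language.Formula.realize_not.2 fun hr => hne h ⟨hh, Set.mem_iInter₂.2 ?_⟩
          exact fun φ hφ => (hre _ _).2 (Language.Formula.realize_iInf.1 hr ⟨φ, hφ⟩)
        exact Language.Formula.realize_not.1 (hy _ h1)
          (Language.Formula.realize_iInf.2 fun φ => φ.1.2)
    have hhy' : ∀ φ : L.Formula (δ ⊕ δ), φ.Realize (Sum.elim b y) →
        φ.Realize (Sum.elim b (h • b)) := fun φ hφ =>
      (hre φ h).1 (Set.mem_iInter.1 hhy ⟨φ, hφ⟩)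
    obtain ⟨s, hs1, hs2⟩ := exists_smul_eq_of_prm hM hδ hδ (c := y) (d := h • b) (prm := b)
      fun φ hφ => by
        have h1 := hhy' (φ.relabel Sum.swap)
        simp only [Language.Formula.realize_relabel, Sum.elim_swap] at h1
        exact h1 hφ
    set s' : Ge pE a := ⟨s, hb s fun i => congrFun hs2 i⟩
    refine ⟨s'⁻¹ * h, mul_mem (inv_mem (hbH s' hs2)) hh, ?_⟩
    rw [mul_smul, eq_inv_smul_iff]
    exact hs1
  · rintro ⟨h, hh, rfl⟩ φ hφ
    exact hφ h hh

theorem frel_orbitType_iff {x y : δ → M} :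
    Frel (orbitType H b) x y ↔ ∃ g : M ≃[L] M, ∃ h ∈ H, x = g • b ∧ y = g • h • b := by
  constructor
  · intro hxy
    obtain ⟨g, rfl⟩ := exists_smul_eq hM hδ (c := b) (d := x) fun φ hφ => by
      have h1 : φ.relabel Sum.inl ∈ orbitType H b := fun h _ => by
        rwa [Language.Formula.realize_relabel, Sum.elim_comp_inl]
      have h2 := hxy _ h1
      rwa [Language.Formula.realize_relabel, Sum.elim_comp_inl] at h2
    rw [← smul_inv_smul g y, frel_smul,
      frel_orbitType_base_iff hM hδ hb hbH hrb hH] at hxy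
    obtain ⟨h, hh, hy⟩ := hxy
    exact ⟨g, h, hh, rfl, by rw [← hy, smul_inv_smul]⟩
  · rintro ⟨g, h, hh, rfl, rfl⟩
    exact (frel_smul _ g _ _).2
      ((frel_orbitType_base_iff hM hδ hb hbH hrb hH).2 ⟨h, hh, rfl⟩)

theorem equivalence_orbitRel : Equivalence (Frel (M := M) (orbitRel H b)) := by
  have key := @frel_orbitType_iff L M _ κ γ pE a δ H b hM hδ hb hbH τ t rb hrb hH
  constructor
  · exact fun x => frel_orbitRel_iff.2 (.inl rfl)
  · intro x y hxy
    rw [frel_orbitRel_iff, key] at hxy ⊢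
    rcases hxy with rfl | ⟨g, h, hh, rfl, rfl⟩
    · exact .inl rfl
    · refine .inr ⟨g * h, h⁻¹, inv_mem hh, (mul_smul g (h : M ≃[L] M) b).symm, ?_⟩
      change g • b = (g * h : M ≃[L] M) • (h : M ≃[L] M)⁻¹ • b
      rw [mul_smul, smul_inv_smul]
  · intro x y z hxy hyz
    rw [frel_orbitRel_iff, key] at hxy hyz ⊢
    rcases hxy with rfl | ⟨g, h, hh, rfl, rfl⟩
    · exact hyz
    rcases hyz with rfl | ⟨g', h', hh', hgg', rfl⟩
    · exact .inr ⟨g, h, hh, rfl, rfl⟩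
    · have hs : (g'⁻¹ * g * h : M ≃[L] M) • b = b := by
        rw [mul_smul, mul_smul, inv_smul_eq_iff]
        exact hgg'
      set s : Ge pE a := ⟨_, hb _ fun i => congrFun hs i⟩
      have hsH : s ∈ H := hbH s hs
      refine .inr ⟨g, h * s⁻¹ * h', mul_mem (mul_mem hh (inv_mem hsH)) hh', rfl, ?_⟩
      change g' • (h' : M ≃[L] M) • b =
        g • ((h : M ≃[L] M) * (g'⁻¹ * g * (h : M ≃[L] M))⁻¹ * (h' : M ≃[L] M)) • b
      rw [smul_smul, smul_smul]
      congr 1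
      group

theorem finiteClass_orbitRel [H.FiniteIndex] : FiniteClass pE a (orbitRel H b) b := by
  have hF := equivalence_orbitRel hM hδ hb hbH hrb hH
  have : Finite (Ge pE a ⧸ H) := Subgroup.finite_quotient_of_finiteIndex
  refine (Set.finite_range fun q : Ge pE a ⧸ H => q.out • Fclass (orbitRel H b) b).subset ?_
  rintro _ ⟨g, rfl⟩
  refine ⟨(g : Ge pE a ⧸ H), ?_⟩
  obtain ⟨h, hh⟩ := QuotientGroup.mk_out_eq_mul H g
  have h1 : Fclass (orbitRel H b) b = (h : Ge pE a) • Fclass (orbitRel H b) b := by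
    change Fclass _ b = ((h : Ge pE a) : M ≃[L] M) • Fclass (orbitRel H b) b
    rw [smul_Fclass, Fclass_eq_iff hF, frel_orbitRel_iff,
      frel_orbitType_base_iff hM hδ hb hbH hrb hH]
    exact .inr ⟨h, h.2, rfl⟩
  change (g : Ge pE a ⧸ H).out • Fclass (orbitRel H b) b = g • Fclass (orbitRel H b) b
  rw [hh, mul_smul, ← h1]

theorem mem_of_fixesClass_orbitRel {f : Ge pE a}
    (hf : FixesClass pE a f (orbitRel H b) b) : f ∈ H := by
  rw [fixesClass_iff (equivalence_orbitRel hM hδ hb hbH hrb hH), frel_orbitRel_iff,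
    frel_orbitType_base_iff hM hδ hb hbH hrb hH] at hf
  rcases hf with hf | ⟨h, hh, hf⟩
  · exact hbH f hf.symm
  · have := mul_mem hh (hbH (h⁻¹ * f) (by rw [mul_smul, hf, inv_smul_smul]))
    rwa [mul_inv_cancel_left] at this

end Orbits

end AlgebraicClosure

section Characterization

open Topology

variable {κ : Cardinal.{u}} {γ : Type u} {pE : Set (L.Formula (γ ⊕ γ))} {a : γ → M}
  {V β : Type u} {pS : Set (L.Formula (V ⊕ β))} {bp : β → M}
  {N : L.ElementarySubstructure M} (hN : #N < κ)
  (hNdcl : ∀ g : M ≃[L] M, (∀ x ∈ N, g x = x) → g ∈ AutE pE a)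
  (hM : IsMonster κ L M) (hE : Equivalence (Frel (M := M) pE)) (hV : #V < κ)

include hN hNdcl hM hE hV

theorem fixesAllAclS_of_mem_AutfSset (hγ : #γ < κ) {f : Ge pE a} (hf : f ∈ AutfSset κ pE a N) :
    fixesAllAclS κ pE a pS bp f := by
  intro ι pF c hι hF hc
  have hδ := mk_prod_lt hM hι hV
  exact fixesClass_of_mem_AutfSset (t := Sum.elim a (Sum.elim Subtype.val (flat c)))
    (r := Sum.inl) (rN := Sum.inr ∘ Sum.inl) (rx := Sum.inr ∘ Sum.inr) hN hNdcl hM hE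
    (mk_sum_lt hM hγ (mk_sum_lt hM hN hδ)) rfl rfl hδ hF hc hf

variable {hInv : SolInv pE a pS bp} {ιb : Type u} {b : ιb → SolT pS bp}
  (hb : IsLascarTuple κ pE a hInv b) (hbdcl : eInDclTuple pE a (flat b))

include hb hbdcl

theorem mk_mem_relSubgroup_of_fixesAllAclS {f : Ge pE a} (hf : fixesAllAclS κ pE a pS bp f)
    {τ : Type u} (hτ : #τ < κ) {t : τ → M} {r : γ → τ} (hr : t ∘ r = a) {rN : N → τ}
    (hrN : t ∘ rN = Subtype.val) {rb : ιb × V → τ} (hrb : t ∘ rb = flat b) :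
    letI := orbTop pE a t
    ∀ U : OpenSubgroup (Ge pE a ⧸ AutfL κ pE a),
      (f : Ge pE a ⧸ AutfL κ pE a) ∈ relSubgroup κ hInv U.1 := by
  let := orbTop pE a t
  have := isTopologicalGroup_lascar hN hNdcl hM hE hτ hr hrN
  have := compactSpace_orbTop t hM hE hτ hr
  intro U
  have hfin := Subgroup.quotient_finite_of_isOpen (relSubgroup κ hInv U.1)
    (Subgroup.isOpen_mono (le_sup_left : U.1 ≤ relSubgroup κ hInv U.1) U.2)
  have hfi : (relSubgroup κ hInv U.1).FiniteIndex := Subgroup.finiteIndex_of_finite_quotient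
  set H := (relSubgroup κ hInv U.1).comap (QuotientGroup.mk' (AutfL κ pE a))
  have hHfi : H.FiniteIndex := ⟨by
    rw [Subgroup.index_comap_of_surjective _ (QuotientGroup.mk'_surjective _)]
    exact hfi.index_ne_zero⟩
  have hH : IsCompact (H : Set (Ge pE a)) :=
    (isClopen_mk_mem_relSubgroup hN hNdcl hM hE hτ hr hrN U).isClosed.isCompact
  have hbH : ∀ g : Ge pE a, g • flat b = flat b → g ∈ H := fun g hg =>
    mk_mem_relSubgroup.2 ⟨1, one_mem U, (projS_eq_iff.2 (by
      rw [inv_one, one_mul]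
      exact hb.toGS_mem_of_smul_eq hg)).symm⟩
  have hδ := mk_prod_lt hM hb.1 hV
  exact mem_of_fixesClass_orbitRel hM hδ hbdcl hbH hrb hH (hf ιb _ b hb.1
    (equivalence_orbitRel hM hδ hbdcl hbH hrb hH) (finiteClass_orbitRel hM hδ hbdcl hbH hrb hH))

/-- If `f` fixes `acl(e) ∩ Σ`, or induces an element of the connected component of the relativized
Lascar group, then it preserves Shelah strong types of tuples in `Σ`. -/
theorem seq_smul (hγ : #γ < κ) {f : Ge pE a} (hf : fixesAllAclS κ pE a pS bp f ∨
      projS κ pE a hInv f ∈ @connectedComponent _ (galTopb κ pE a hInv b) (projb κ pE a hInv 1))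
    {ι : Type u} (hι : #ι < κ) (c : ι → SolT pS bp) :
    Seq κ pE a N (flat c) (f • flat c) := by
  set t := Sum.elim a (Sum.elim (Subtype.val : N → M) (flat b))
  have hr : t ∘ Sum.inl = a := rfl
  have hrN : t ∘ Sum.inr ∘ Sum.inl = Subtype.val := rfl
  have hrb : t ∘ Sum.inr ∘ Sum.inr = flat b := rfl
  have hτ := mk_sum_lt hM hγ (mk_sum_lt hM hN (mk_prod_lt hM hb.1 hV))
  obtain ⟨u, hu, hfu⟩ := exists_mem_AutfSset hN hNdcl hM hE hτ hr hrN hb hrb (f := f) fun U =>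
    mk_mem_relSubgroup.1 (hf.elim
      (fun h => mk_mem_relSubgroup_of_fixesAllAclS hN hNdcl hM hE hV hb hbdcl h hτ hr hrN hrb U)
      fun h => mk_mem_relSubgroup_of_mem_connectedComponent hN hNdcl hM hE hτ hr hrN hV hb hbdcl
        hrb h U)
  exact seq_of_mem_AutfSset hu hfu hι c

end Characterization

section Statements

variable {γ : Type u} (pE : Set (L.Formula (γ ⊕ γ))) (a : γ → M)
variable {V β : Type u} {pS : Set (L.Formula (V ⊕ β))} {bp : β → M}


/-- Corollary 2.19(2): for tuples `c`, `d` of realizations of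
`Σ`, the following are equivalent: (a) `c ≡ˢ_e d`; (b) `c ≡_{acl(e)∩Σ} d`;
(c) there is `σ ∈ π_b⁻¹[Gal_L^0(Σ, e)]` with `σ(c) = d`. -/
theorem Seq_char_aclS (hM : IsMonster κ L M) (hγ : #γ < κ)
    (hE : Equivalence (Frel (M := M) pE)) (hV : #V < κ) (hβ : #β < κ)
    (hInv : SolInv pE a pS bp)
    (hedcl : eInDclSigma κ pE a pS bp)
    {ιb : Type u} (b : ιb → SolT pS bp)
    (hb : IsLascarTuple κ pE a hInv b) (hbdcl : eInDclTuple pE a (flat b))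
    (N : L.ElementarySubstructure M) (hN : #N < κ)
    (hNdcl : ∀ g : M ≃[L] M, (∀ x ∈ N, g x = x) → g ∈ AutE pE a)
    {ι : Type u} (hι : #ι < κ) (c d : ι → SolT pS bp) :
    (Seq κ pE a N (flat c) (flat d) ↔
      ∃ f : Ge pE a, fixesAllAclS κ pE a pS bp f ∧ f • flat c = flat d) ∧
    (Seq κ pE a N (flat c) (flat d) ↔
      ∃ σ ∈ projb κ pE a hInv ⁻¹'
          (@connectedComponent _ (galTopb κ pE a hInv b) (projb κ pE a hInv 1)),
        σ • c = d) := by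
  constructor
  · constructor
    · rintro ⟨f, hf, hcd⟩
      exact ⟨f, fixesAllAclS_of_mem_AutfSset hN hNdcl hM hE hV hγ hf, hcd⟩
    · rintro ⟨f, hf, hcd⟩
      rw [← hcd]
      exact seq_smul hN hNdcl hM hE hV hb hbdcl hγ (.inl hf) hι c
  · constructor
    · rintro ⟨f, hf, hcd⟩
      refine ⟨toGS pE a hInv f, ?_, flat_injective ((flat_toGS_smul pE a hInv f c).trans hcd)⟩
      exact projS_mem_connectedComponent (t := Sum.elim a (Sum.elim Subtype.val (flat b)))
        (r := Sum.inl) (rN := Sum.inr ∘ Sum.inl) (rb := Sum.inr ∘ Sum.inr) hN hNdcl hM hE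
        (mk_sum_lt hM hγ (mk_sum_lt hM hN (mk_prod_lt hM hb.1 hV))) rfl rfl hV hb hbdcl rfl hf
    · rintro ⟨σ, hσ, hcd⟩
      obtain ⟨f, rfl⟩ := (resPerm pE a hInv).rangeRestrict_surjective σ
      rw [← hcd]
      exact seq_smul hN hNdcl hM hE hV hb hbdcl hγ (.inr hσ) hι c

end Statements

end RelLascar
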